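/- There is a function f : ℕ → ℕ, bounded above by a polynomial, such that the following holds for all integers t ≥ 2 and ℓ ≥ 2: if U is a finite simple graph with no K_t-minor that contains every triangulated ℓ×ℓ double grid as a subgraph, then |V(U)| ≥ 2^{ℓ²/f(t)}. -/

import Mathlib

open SimpleGraph

/-- `H` is a minor of `G`: there are pairwise disjoint, connected (hence nonempty) branch
sets, one for each vertex of `H`, with an edge of `G` between the branch sets of any two
adjacent vertices of `H`. -/
def SimpleGraph.HasMinor {α : Type*} {β : Type*} (G : SimpleGraph α) (H : SimpleGraph β) : Prop :=
  ∃ B : β → Set α,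
    (∀ b, (SimpleGraph.induce (B b) G).Connected) ∧
    (Pairwise fun b b' => Disjoint (B b) (B b')) ∧
    (∀ b b', H.Adj b b' → ∃ u ∈ B b, ∃ v ∈ B b', G.Adj u v)
/-- `U` contains `H` as a subgraph. -/
def ContainsSub {α β : Type*} (U : SimpleGraph β) (H : SimpleGraph α) : Prop :=
  ∃ f : α → β, Function.Injective f ∧ ∀ a b, H.Adj a b → U.Adj (f a) (f b)
/-- Adjacency in the `a × b` grid. -/
def gridAdj {a b : ℕ} (p q : Fin a × Fin b) : Prop :=
  (p.1 = q.1 ∧ (p.2.val + 1 = q.2.val ∨ q.2.val + 1 = p.2.val)) ∨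
  (p.2 = q.2 ∧ (p.1.val + 1 = q.1.val ∨ q.1.val + 1 = p.1.val))

/-- `p` and `q` are diagonally adjacent positions in the `a × b` grid. -/
def diagAdj {a b : ℕ} (p q : Fin a × Fin b) : Prop :=
  (p.1.val + 1 = q.1.val ∨ q.1.val + 1 = p.1.val) ∧
  (p.2.val + 1 = q.2.val ∨ q.2.val + 1 = p.2.val)

/-- `G` is a triangulated `a × b` grid: it contains all grid edges, every edge is a grid
edge or a diagonal, and in each unit cell (with corners `p`, `q`, `r`, `s`, where
`r = p + (1,1)`, `q = p + (1,0)`, `s = p + (0,1)`) exactly one of the two diagonals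
is present. -/
def IsTriangulatedGrid {a b : ℕ} (G : SimpleGraph (Fin a × Fin b)) : Prop :=
  (∀ p q, gridAdj p q → G.Adj p q) ∧
  (∀ p q, G.Adj p q → gridAdj p q ∨ diagAdj p q) ∧
  (∀ p q r s : Fin a × Fin b,
    p.1.val + 1 = r.1.val → p.2.val + 1 = r.2.val →
    q.1.val = r.1.val → q.2.val = p.2.val →
    s.1.val = p.1.val → s.2.val = r.2.val →
    Xor' (G.Adj p r) (G.Adj q s))

/-- `p` lies on the boundary of the `ℓ × ℓ` grid. -/
def onBoundary {ℓ : ℕ} (p : Fin ℓ × Fin ℓ) : Prop :=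
  p.1.val = 0 ∨ p.1.val = ℓ - 1 ∨ p.2.val = 0 ∨ p.2.val = ℓ - 1

/-- `H` is a triangulated `ℓ × ℓ` double grid: two triangulated `ℓ × ℓ` grids, a perfect
matching between the two copies of the grid boundary, and exactly one diagonal inside each
quadrangular face created by two consecutive matching edges. -/
def IsTriangulatedDoubleGrid {ℓ : ℕ} (H : SimpleGraph (Fin 2 × Fin ℓ × Fin ℓ)) : Prop :=
  ∃ G₁ G₂ : SimpleGraph (Fin ℓ × Fin ℓ),
    IsTriangulatedGrid G₁ ∧ IsTriangulatedGrid G₂ ∧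
    (∀ p q, H.Adj (0, p) (0, q) ↔ G₁.Adj p q) ∧
    (∀ p q, H.Adj (1, p) (1, q) ↔ G₂.Adj p q) ∧
    (∀ p, H.Adj (0, p) (1, p) ↔ onBoundary p) ∧
    (∀ p q, p ≠ q → H.Adj (0, p) (1, q) → onBoundary p ∧ onBoundary q ∧ gridAdj p q) ∧
    (∀ p q, gridAdj p q → onBoundary p → onBoundary q →
      Xor' (H.Adj (0, p) (1, q)) (H.Adj (0, q) (1, p)))

namespace GridMinor

section Connectivity

variable {V : Type*} {U : SimpleGraph V}

/-- The set `s` induces a connected subgraph of `U`. -/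
def ConnOn (U : SimpleGraph V) (s : Set V) : Prop := (U.induce s).Connected

/-- Some edge of `U` joins `s` to `s'`. -/
def Linked (U : SimpleGraph V) (s s' : Set V) : Prop := ∃ u ∈ s, ∃ v ∈ s', U.Adj u v

theorem Linked.symm {s s' : Set V} (h : Linked U s s') : Linked U s' s := by
  obtain ⟨u, hu, v, hv, huv⟩ := h
  exact ⟨v, hv, u, hu, huv.symm⟩

theorem Linked.mono {s s' r r' : Set V} (h : Linked U s s') (hr : s ⊆ r) (hr' : s' ⊆ r') :
    Linked U r r' := by
  obtain ⟨u, hu, v, hv, huv⟩ := h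
  exact ⟨u, hr hu, v, hr' hv, huv⟩

theorem connOn_singleton (v : V) : ConnOn U {v} := by
  have : Subsingleton ({v} : Set V) := ⟨fun a b => Subtype.ext (a.2.trans b.2.symm)⟩
  exact { preconnected := fun a b => by rw [Subsingleton.elim a b], nonempty := ⟨⟨v, rfl⟩⟩ }

theorem ConnOn.union {s s' : Set V} (h : ConnOn U s) (h' : ConnOn U s')
    (hi : (s ∩ s').Nonempty) : ConnOn U (s ∪ s') :=
  induce_union_connected h.preconnected h'.preconnected hi

theorem ConnOn.union_of_linked {s s' : Set V} (h : ConnOn U s) (h' : ConnOn U s')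
    (hl : Linked U s s') : ConnOn U (s ∪ s') := by
  obtain ⟨u, hu, v, hv, huv⟩ := hl
  have h1 : ConnOn U (s ∪ {u, v}) :=
    h.union (induce_pair_connected_of_adj huv) ⟨u, hu, by simp⟩
  have h2 : ConnOn U (s ∪ {u, v} ∪ s') := h1.union h' ⟨v, by simp, hv⟩
  convert h2 using 1
  ext x
  simp only [Set.mem_union, Set.mem_insert_iff, Set.mem_singleton_iff]
  constructor
  · tauto
  · rintro ((h | rfl | rfl) | h) <;> tauto

/-- A chain of connected sets, consecutive ones being linked, has a connected union. -/
theorem connOn_chain {X : ℕ → Set V} {a b : ℕ} (hab : a ≤ b)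
    (hX : ∀ n, a ≤ n → n ≤ b → ConnOn U (X n))
    (hl : ∀ n, a ≤ n → n < b → Linked U (X n) (X (n + 1))) :
    ConnOn U {v | ∃ n, a ≤ n ∧ n ≤ b ∧ v ∈ X n} := by
  induction b, hab using Nat.le_induction with
  | base =>
    convert hX a le_rfl le_rfl using 1
    ext v
    constructor
    · rintro ⟨n, h1, h2, h3⟩
      rwa [le_antisymm h2 h1] at h3
    · exact fun h => ⟨a, le_rfl, le_rfl, h⟩
  | succ b hab ih =>
    have h1 := ih (fun n h1 h2 => hX n h1 (by omega)) (fun n h1 h2 => hl n h1 (by omega))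
    have h2 := h1.union_of_linked (hX (b + 1) (by omega) le_rfl)
      ((hl b hab (by omega)).mono (fun v hv => ⟨b, hab, le_rfl, hv⟩) subset_rfl)
    convert h2 using 1
    ext v
    constructor
    · rintro ⟨n, h1, h2, h3⟩
      rcases Nat.lt_or_ge b n with h | h
      · right
        rwa [show n = b + 1 by omega] at h3
      · exact Or.inl ⟨n, h1, h, h3⟩
    · rintro (⟨n, h1, h2, h3⟩ | h)
      · exact ⟨n, h1, by omega, h3⟩
      · exact ⟨b + 1, by omega, le_rfl, h⟩

/-- A crossing array of `t` row-like connected strings and `t` column-like connected strings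
yields a `K_t`-minor. -/
theorem hasMinor_of_array {t : ℕ} (X Y : Fin t → Fin t → Set V)
    (hX : ∀ i j, ConnOn U (X i j)) (hY : ∀ i j, ConnOn U (Y i j))
    (hXX : ∀ i j j' : Fin t, j.val + 1 = j'.val → Linked U (X i j) (X i j'))
    (hYY : ∀ i i' j : Fin t, i.val + 1 = i'.val → Linked U (Y i j) (Y i' j))
    (hXY : ∀ i j, Linked U (X i j) (Y i j))
    (dX : ∀ i i' j j', i ≠ i' → Disjoint (X i j) (X i' j'))
    (dY : ∀ i i' j j', j ≠ j' → Disjoint (Y i j) (Y i' j'))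
    (dXY : ∀ i i' j j', Disjoint (X i j) (Y i' j')) :
    U.HasMinor (⊤ : SimpleGraph (Fin t)) := by
  rcases Nat.eq_zero_or_pos t with rfl | ht
  · exact ⟨fun _ => ∅, fun b => b.elim0, fun b => b.elim0, fun b => b.elim0⟩
  let R : Fin t → Set V := fun i => {v | ∃ j, v ∈ X i j}
  let C : Fin t → Set V := fun j => {v | ∃ i, v ∈ Y i j}
  have hR : ∀ i, ConnOn U (R i) := by
    intro i
    let X' : ℕ → Set V := fun n => if h : n < t then X i ⟨n, h⟩ else ∅
    have h := connOn_chain (U := U) (X := X') (Nat.zero_le (t - 1))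
      (fun n _ h => by
        have hn : n < t := by omega
        simp only [X', hn, dite_true]
        exact hX _ _)
      (fun n _ h => by
        have hn : n < t := by omega
        have hn' : n + 1 < t := by omega
        simp only [X', hn, hn', dite_true]
        exact hXX _ _ _ rfl)
    convert h using 1
    ext v
    constructor
    · rintro ⟨j, hj⟩
      exact ⟨j, Nat.zero_le _, by omega, by simpa [X'] using hj⟩
    · rintro ⟨n, _, hn, hv⟩
      have hn' : n < t := by omega
      simp only [X', hn', dite_true] at hv
      exact ⟨_, hv⟩
  have hC : ∀ j, ConnOn U (C j) := by
    intro j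
    let Y' : ℕ → Set V := fun n => if h : n < t then Y ⟨n, h⟩ j else ∅
    have h := connOn_chain (U := U) (X := Y') (Nat.zero_le (t - 1))
      (fun n _ h => by
        have hn : n < t := by omega
        simp only [Y', hn, dite_true]
        exact hY _ _)
      (fun n _ h => by
        have hn : n < t := by omega
        have hn' : n + 1 < t := by omega
        simp only [Y', hn, hn', dite_true]
        exact hYY _ _ _ rfl)
    convert h using 1
    ext v
    constructor
    · rintro ⟨j, hj⟩
      exact ⟨j, Nat.zero_le _, by omega, by simpa [Y'] using hj⟩
    · rintro ⟨n, _, hn, hv⟩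
      have hn' : n < t := by omega
      simp only [Y', hn', dite_true] at hv
      exact ⟨_, hv⟩
  refine ⟨fun i => R i ∪ C i, fun i => ?_, fun i i' hii' => ?_, fun i i' _ => ?_⟩
  · exact (hR i).union_of_linked (hC i)
      ((hXY i i).mono (fun v hv => ⟨i, hv⟩) (fun v hv => ⟨i, hv⟩))
  · refine Set.disjoint_left.2 ?_
    rintro v (⟨j, hj⟩ | ⟨j, hj⟩) (⟨j', hj'⟩ | ⟨j', hj'⟩)
    · exact Set.disjoint_left.1 (dX i i' j j' hii') hj hj'
    · exact Set.disjoint_left.1 (dXY _ _ _ _) hj hj'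
    · exact Set.disjoint_left.1 (dXY _ _ _ _) hj' hj
    · exact Set.disjoint_left.1 (dY j j' i i' hii') hj hj'
  · exact (hXY i i').mono (fun v hv => Or.inl ⟨i', hv⟩) (fun v hv => Or.inr ⟨i, hv⟩)

end Connectivity

section Grid

/-- Adjacency in the triangulation of the quadrant `ℕ × ℕ` in which the unit cell with lower
corner `(x, y)` contains its main diagonal iff `d x y = true`. -/
def TAdj (d : ℕ → ℕ → Bool) (p q : ℕ × ℕ) : Prop :=
  (p.1 = q.1 ∧ (p.2 + 1 = q.2 ∨ q.2 + 1 = p.2)) ∨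
  (p.2 = q.2 ∧ (p.1 + 1 = q.1 ∨ q.1 + 1 = p.1)) ∨
  (p.1 + 1 = q.1 ∧ p.2 + 1 = q.2 ∧ d p.1 p.2 = true) ∨
  (q.1 + 1 = p.1 ∧ q.2 + 1 = p.2 ∧ d q.1 q.2 = true) ∨
  (p.1 + 1 = q.1 ∧ q.2 + 1 = p.2 ∧ d p.1 q.2 = false) ∨
  (q.1 + 1 = p.1 ∧ p.2 + 1 = q.2 ∧ d q.1 p.2 = false)

theorem TAdj.symm {d : ℕ → ℕ → Bool} {p q : ℕ × ℕ} (h : TAdj d p q) : TAdj d q p := by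
  unfold TAdj at *
  rcases h with ⟨h, h'⟩ | ⟨h, h'⟩ | h | h | h | h
  · exact Or.inl ⟨h.symm, h'.symm⟩
  · exact Or.inr (Or.inl ⟨h.symm, h'.symm⟩)
  all_goals tauto

theorem TAdj.swap {d : ℕ → ℕ → Bool} {p q : ℕ × ℕ} (h : TAdj d p q) :
    TAdj (fun x y => d y x) p.swap q.swap := by
  unfold TAdj at *
  simp only [Prod.fst_swap, Prod.snd_swap]
  tauto

variable {V : Type*} {U : SimpleGraph V} {L : ℕ} {d : ℕ → ℕ → Bool} {ψ : ℕ × ℕ → V}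

/-- `ψ` embeds the `L × L` part of the triangulation given by `d` into `U`. -/
structure GridEmb (U : SimpleGraph V) (L : ℕ) (d : ℕ → ℕ → Bool) (ψ : ℕ × ℕ → V) : Prop where
  inj : ∀ p q : ℕ × ℕ, p.1 < L → p.2 < L → q.1 < L → q.2 < L → ψ p = ψ q → p = q
  adj : ∀ p q : ℕ × ℕ, p.1 < L → p.2 < L → q.1 < L → q.2 < L → TAdj d p q → U.Adj (ψ p) (ψ q)

theorem GridEmb.swap (h : GridEmb U L d ψ) :
    GridEmb U L (fun x y => d y x) (fun p => ψ p.swap) where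
  inj _ _ h1 h2 h3 h4 e := Prod.swap_injective (h.inj _ _ h2 h1 h4 h3 e)
  adj _ _ h1 h2 h3 h4 e := h.adj _ _ h2 h1 h4 h3 e.swap

theorem GridEmb.connOn_row (h : GridEmb U L d ψ) {r c₁ c₂ : ℕ} (hr : r < L) (hc : c₁ ≤ c₂)
    (hL : c₂ < L) : ConnOn U (ψ '' {z | z.1 = r ∧ c₁ ≤ z.2 ∧ z.2 ≤ c₂}) := by
  convert connOn_chain (U := U) (X := fun n => {ψ (r, n)}) hc (fun n _ _ => connOn_singleton _)
    (fun n h1 h2 => ⟨_, rfl, _, rfl, h.adj _ _ hr (by simp; omega) hr (by simp; omega)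
      (Or.inl ⟨rfl, Or.inl rfl⟩)⟩) using 1
  ext v
  constructor
  · rintro ⟨⟨x, y⟩, ⟨rfl, h1, h2⟩, rfl⟩
    exact ⟨y, h1, h2, rfl⟩
  · rintro ⟨n, h1, h2, rfl⟩
    exact ⟨(r, n), ⟨rfl, h1, h2⟩, rfl⟩

theorem GridEmb.connOn_col (h : GridEmb U L d ψ) {c r₁ r₂ : ℕ} (hc : c < L) (hr : r₁ ≤ r₂)
    (hL : r₂ < L) : ConnOn U (ψ '' {z | z.2 = c ∧ r₁ ≤ z.1 ∧ z.1 ≤ r₂}) := by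
  convert h.swap.connOn_row hc hr hL using 1
  ext v
  constructor
  · rintro ⟨⟨x, y⟩, h, rfl⟩
    exact ⟨(y, x), h, rfl⟩
  · rintro ⟨⟨x, y⟩, h, rfl⟩
    exact ⟨(y, x), h, rfl⟩

/-- A union of consecutive row segments, consecutive ones being linked, is connected. -/
theorem GridEmb.connOn_rows (h : GridEmb U L d ψ) {r₁ r₂ : ℕ} (lo hi : ℕ → ℕ) (hr : r₁ ≤ r₂)
    (hL : r₂ < L) (hhi : ∀ r, r₁ ≤ r → r ≤ r₂ → lo r ≤ hi r ∧ hi r < L)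
    (hl : ∀ r, r₁ ≤ r → r < r₂ → ∃ c c', lo r ≤ c ∧ c ≤ hi r ∧ lo (r + 1) ≤ c' ∧
      c' ≤ hi (r + 1) ∧ TAdj d (r, c) (r + 1, c')) :
    ConnOn U (ψ '' {z | r₁ ≤ z.1 ∧ z.1 ≤ r₂ ∧ lo z.1 ≤ z.2 ∧ z.2 ≤ hi z.1}) := by
  convert connOn_chain (U := U)
    (X := fun n => ψ '' {z | z.1 = n ∧ lo n ≤ z.2 ∧ z.2 ≤ hi n}) hr
    (fun n h1 h2 => h.connOn_row (by omega) (hhi n h1 h2).1 (hhi n h1 h2).2)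
    (fun n h1 h2 => ?_) using 1
  · ext v
    constructor
    · rintro ⟨⟨x, y⟩, ⟨h1, h2, h3, h4⟩, rfl⟩
      exact ⟨x, h1, h2, (x, y), ⟨rfl, h3, h4⟩, rfl⟩
    · rintro ⟨n, h1, h2, ⟨x, y⟩, ⟨h3, h4, h5⟩, rfl⟩
      simp only at h3
      subst h3
      exact ⟨(x, y), ⟨h1, h2, h4, h5⟩, rfl⟩
  · obtain ⟨c, c', h3, h4, h5, h6, h7⟩ := hl n h1 h2
    have h8 := (hhi n h1 h2.le).2
    have h9 := (hhi (n + 1) (by omega) (by omega)).2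
    exact ⟨_, ⟨(n, c), ⟨rfl, h3, h4⟩, rfl⟩, _, ⟨(n + 1, c'), ⟨rfl, h5, h6⟩, rfl⟩,
      h.adj _ _ (by simp; omega) (by simp; omega) (by simp; omega) (by simp; omega) h7⟩

/-- The square `[a, b] × [a', b']` with a full row `ρ` and a full column `κ` of the rectangle
`[x₀, x₁] × [y₀, y₁]`. -/
def crossSet (x₀ x₁ y₀ y₁ a b a' b' ρ κ : ℕ) : Set (ℕ × ℕ) :=
  {z | (a ≤ z.1 ∧ z.1 ≤ b ∧ a' ≤ z.2 ∧ z.2 ≤ b') ∨ (z.1 = ρ ∧ y₀ ≤ z.2 ∧ z.2 ≤ y₁) ∨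
    (z.2 = κ ∧ x₀ ≤ z.1 ∧ z.1 ≤ x₁)}

/-- Two disjoint linked strings, one joining the left and right ends of a row, the other the top
and bottom ends of a column, all inside `S ∪ E`. -/
def Crosses (U : SimpleGraph V) (S : Set V) (l r u l' : V) : Prop :=
  ∃ X Y : Set V, X ⊆ S ∧ Y ⊆ S ∧ ConnOn U X ∧ ConnOn U Y ∧ Disjoint X Y ∧
    Linked U X Y ∧ l ∈ X ∧ r ∈ X ∧ u ∈ Y ∧ l' ∈ Y

theorem Crosses.symm {S : Set V} {l r u l' : V} (h : Crosses U S l r u l') :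
    Crosses U S u l' l r := by
  obtain ⟨X, Y, h1, h2, h3, h4, h5, h6, h7, h8, h9, h10⟩ := h
  exact ⟨Y, X, h2, h1, h4, h3, h5.symm, h6.symm, h9, h10, h7, h8⟩

/-- If `c` is a top-bottom path of the square and an ear `E` joins a point on its left to a point
on its right, then the row and the column can be made to cross. -/
theorem GridEmb.crosses_of_separator (h : GridEmb U L d ψ)
    {x₀ x₁ y₀ y₁ a b a' b' ρ κ : ℕ} (hx₀ : x₀ ≤ a) (haρ : a < ρ) (hρb : ρ < b) (hbx : b ≤ x₁)
    (hx₁ : x₁ < L) (hy₀ : y₀ ≤ a') (haκ : a' < κ) (hκb : κ < b') (hby : b' ≤ y₁) (hy₁ : y₁ < L)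
    (c : ℕ → ℕ) (hc : ∀ r, a ≤ r → r ≤ b → a' < c r ∧ c r < b')
    (hcc : ∀ r, a ≤ r → r < b → TAdj d (r, c r) (r + 1, c (r + 1)))
    {p q : ℕ × ℕ} (hp : a < p.1 ∧ p.1 < b ∧ a' < p.2 ∧ p.2 < c p.1)
    (hq : a < q.1 ∧ q.1 < b ∧ c q.1 < q.2 ∧ q.2 < b') {E : Set V}
    (hE : ConnOn U (insert (ψ p) (insert (ψ q) E)))
    (hd : Disjoint E (ψ '' crossSet x₀ x₁ y₀ y₁ a b a' b' ρ κ)) :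
    Crosses U (ψ '' crossSet x₀ x₁ y₀ y₁ a b a' b' ρ κ ∪ E)
      (ψ (ρ, y₀)) (ψ (ρ, y₁)) (ψ (x₀, κ)) (ψ (x₁, κ)) := by
  obtain ⟨p₁, p₂⟩ := p
  obtain ⟨q₁, q₂⟩ := q
  simp only at hp hq
  have hca := hc a (by omega) (by omega)
  have hcb := hc b (by omega) (by omega)
  have hcρ := hc ρ (by omega) (by omega)
  let X₁ : Set (ℕ × ℕ) := {z | z.1 = ρ ∧ y₀ ≤ z.2 ∧ z.2 ≤ a'}
  let X₂ : Set (ℕ × ℕ) := {z | a + 1 ≤ z.1 ∧ z.1 ≤ b - 1 ∧ a' ≤ z.2 ∧ z.2 ≤ c z.1 - 1}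
  let X₃ : Set (ℕ × ℕ) := {z | a + 1 ≤ z.1 ∧ z.1 ≤ b - 1 ∧ c z.1 + 1 ≤ z.2 ∧ z.2 ≤ b'}
  let X₄ : Set (ℕ × ℕ) := {z | z.1 = ρ ∧ b' ≤ z.2 ∧ z.2 ≤ y₁}
  let Y₁ : Set (ℕ × ℕ) := {z | z.2 = κ ∧ x₀ ≤ z.1 ∧ z.1 ≤ a}
  let Y₂ : Set (ℕ × ℕ) := {z | z.1 = a ∧ a' ≤ z.2 ∧ z.2 ≤ b'}
  let Y₃ : Set (ℕ × ℕ) := {z | a ≤ z.1 ∧ z.1 ≤ b ∧ c z.1 ≤ z.2 ∧ z.2 ≤ c z.1}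
  let Y₄ : Set (ℕ × ℕ) := {z | z.1 = b ∧ a' ≤ z.2 ∧ z.2 ≤ b'}
  let Y₅ : Set (ℕ × ℕ) := {z | z.2 = κ ∧ b ≤ z.1 ∧ z.1 ≤ x₁}
  have cX₁ : ConnOn U (ψ '' X₁) := h.connOn_row (by omega) hy₀ (by omega)
  have cX₄ : ConnOn U (ψ '' X₄) := h.connOn_row (by omega) hby (by omega)
  have cX₂ : ConnOn U (ψ '' X₂) := by
    refine h.connOn_rows (fun _ => a') (fun r => c r - 1) (by omega) (by omega) ?_ ?_
    · intro r h1 h2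
      have := hc r (by omega) (by omega)
      constructor <;> omega
    · intro r h1 h2
      have := hc r (by omega) (by omega)
      have := hc (r + 1) (by omega) (by omega)
      exact ⟨a', a', by omega, by omega, by omega, by omega, Or.inr (Or.inl ⟨rfl, Or.inl rfl⟩)⟩
  have cX₃ : ConnOn U (ψ '' X₃) := by
    refine h.connOn_rows (fun r => c r + 1) (fun r => b') (by omega) (by omega) ?_ ?_
    · intro r h1 h2
      have := hc r (by omega) (by omega)
      constructor <;> omega
    · intro r h1 h2
      have := hc r (by omega) (by omega)
      have := hc (r + 1) (by omega) (by omega)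
      exact ⟨b', b', by omega, by omega, by omega, by omega, Or.inr (Or.inl ⟨rfl, Or.inl rfl⟩)⟩
  have cY₁ : ConnOn U (ψ '' Y₁) := h.connOn_col (by omega) hx₀ (by omega)
  have cY₅ : ConnOn U (ψ '' Y₅) := h.connOn_col (by omega) hbx (by omega)
  have cY₂ : ConnOn U (ψ '' Y₂) := h.connOn_row (by omega) (by omega) (by omega)
  have cY₄ : ConnOn U (ψ '' Y₄) := h.connOn_row (by omega) (by omega) (by omega)
  have cY₃ : ConnOn U (ψ '' Y₃) := by
    refine h.connOn_rows c c (by omega) (by omega) ?_ ?_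
    · intro r h1 h2
      have := hc r (by omega) (by omega)
      constructor <;> omega
    · intro r h1 h2
      exact ⟨_, _, le_rfl, le_rfl, le_rfl, le_rfl, hcc r h1 h2⟩
  have inter : ∀ (A B : Set (ℕ × ℕ)) (z : ℕ × ℕ), z ∈ A → z ∈ B → (ψ '' A ∩ ψ '' B).Nonempty :=
    fun A B z hA hB => ⟨ψ z, ⟨z, hA, rfl⟩, ⟨z, hB, rfl⟩⟩
  have hpX : (p₁, p₂) ∈ X₂ := ⟨by omega, by omega, by omega, by simp only; omega⟩
  have hqX : (q₁, q₂) ∈ X₃ := ⟨by omega, by omega, by simp only; omega, by omega⟩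
  have cX : ConnOn U (ψ '' (X₁ ∪ X₂) ∪
      insert (ψ (p₁, p₂)) (insert (ψ (q₁, q₂)) E) ∪ ψ '' (X₃ ∪ X₄)) := by
    rw [Set.image_union, Set.image_union]
    refine ConnOn.union (ConnOn.union (cX₁.union cX₂ ?_) hE ?_) (cX₃.union cX₄ ?_) ?_
    · exact inter _ _ (ρ, a') ⟨rfl, hy₀, le_rfl⟩
        ⟨by simp only; omega, by simp only; omega, le_rfl, by simp only; omega⟩
    · exact ⟨_, Or.inr ⟨_, hpX, rfl⟩, by simp⟩
    · exact inter _ _ (ρ, b') ⟨by simp only; omega, by simp only; omega, by simp only; omega, le_rfl⟩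
        ⟨rfl, le_rfl, hby⟩
    · exact ⟨ψ (q₁, q₂), by simp, Or.inl ⟨_, hqX, rfl⟩⟩
  have cY : ConnOn U (ψ '' (Y₁ ∪ Y₂ ∪ Y₃ ∪ (Y₄ ∪ Y₅))) := by
    simp only [Set.image_union]
    refine ConnOn.union (ConnOn.union (cY₁.union cY₂ ?_) cY₃ ?_) (cY₄.union cY₅ ?_) ?_
    · exact inter _ _ (a, κ) ⟨rfl, hx₀, le_rfl⟩ ⟨rfl, haκ.le, hκb.le⟩
    · exact ⟨ψ (a, c a), Or.inr ⟨_, ⟨rfl, hca.1.le, hca.2.le⟩, rfl⟩,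
        ⟨_, ⟨le_rfl, by simp only; omega, le_rfl, le_rfl⟩, rfl⟩⟩
    · exact inter _ _ (b, κ) ⟨rfl, haκ.le, hκb.le⟩ ⟨rfl, le_rfl, hbx⟩
    · exact ⟨ψ (b, c b), Or.inr ⟨_, ⟨by simp only; omega, le_rfl, le_rfl, le_rfl⟩, rfl⟩,
        Or.inl ⟨_, ⟨rfl, hcb.1.le, hcb.2.le⟩, rfl⟩⟩
  have hXs : X₁ ∪ X₂ ∪ (X₃ ∪ X₄) ⊆ crossSet x₀ x₁ y₀ y₁ a b a' b' ρ κ := by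
    rintro ⟨x, y⟩ ((⟨h1, h2, h3⟩ | ⟨h1, h2, h3, h4⟩) | (⟨h1, h2, h3, h4⟩ | ⟨h1, h2, h3⟩)) <;>
      simp only at h1 h2 h3
    · exact Or.inr (Or.inl ⟨by simp only; omega, by simp only; omega, by simp only; omega⟩)
    · have := hc x (by omega) (by omega)
      simp only at h4
      exact Or.inl ⟨by simp only; omega, by simp only; omega, by simp only; omega,
        by simp only; omega⟩
    · have := hc x (by omega) (by omega)
      simp only at h4
      exact Or.inl ⟨by simp only; omega, by simp only; omega, by simp only; omega,
        by simp only; omega⟩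
    · exact Or.inr (Or.inl ⟨by simp only; omega, by simp only; omega, by simp only; omega⟩)
  have hYs : Y₁ ∪ Y₂ ∪ Y₃ ∪ (Y₄ ∪ Y₅) ⊆ crossSet x₀ x₁ y₀ y₁ a b a' b' ρ κ := by
    rintro ⟨x, y⟩ (((⟨h1, h2, h3⟩ | ⟨h1, h2, h3⟩) | ⟨h1, h2, h3, h4⟩) |
      (⟨h1, h2, h3⟩ | ⟨h1, h2, h3⟩)) <;> simp only at h1 h2 h3
    · exact Or.inr (Or.inr ⟨by simp only; omega, by simp only; omega, by simp only; omega⟩)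
    · exact Or.inl ⟨by simp only; omega, by simp only; omega, by simp only; omega,
        by simp only; omega⟩
    · have := hc x (by omega) (by omega)
      simp only at h4
      exact Or.inl ⟨by simp only; omega, by simp only; omega, by simp only; omega,
        by simp only; omega⟩
    · exact Or.inl ⟨by simp only; omega, by simp only; omega, by simp only; omega,
        by simp only; omega⟩
    · exact Or.inr (Or.inr ⟨by simp only; omega, by simp only; omega, by simp only; omega⟩)
  have hbox : ∀ z ∈ crossSet x₀ x₁ y₀ y₁ a b a' b' ρ κ, z.1 < L ∧ z.2 < L := by
    rintro ⟨x, y⟩ (⟨h1, h2, h3, h4⟩ | ⟨h1, h2, h3⟩ | ⟨h1, h2, h3⟩) <;> simp only at * <;>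
      constructor <;> omega
  have hXY : Disjoint (X₁ ∪ X₂ ∪ (X₃ ∪ X₄)) (Y₁ ∪ Y₂ ∪ Y₃ ∪ (Y₄ ∪ Y₅)) := by
    rw [Set.disjoint_left]
    rintro ⟨x, y⟩ ((⟨h1, h2, h3⟩ | ⟨h1, h2, h3, h4⟩) | (⟨h1, h2, h3, h4⟩ | ⟨h1, h2, h3⟩))
      (((⟨k1, k2, k3⟩ | ⟨k1, k2, k3⟩) | ⟨k1, k2, k3, k4⟩) | (⟨k1, k2, k3⟩ | ⟨k1, k2, k3⟩)) <;>
      simp only at * <;> first | omega | (have := hc x (by omega) (by omega); omega)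
  refine ⟨_, _, ?_, ?_, cX, cY, ?_, ?_, ?_, ?_, ?_, ?_⟩
  · rintro v ((⟨z, hz, rfl⟩ | rfl | rfl | hv) | ⟨z, hz, rfl⟩)
    · exact Or.inl ⟨z, hXs (Or.inl hz), rfl⟩
    · exact Or.inl ⟨_, hXs (Or.inl (Or.inr hpX)), rfl⟩
    · exact Or.inl ⟨_, hXs (Or.inr (Or.inl hqX)), rfl⟩
    · exact Or.inr hv
    · exact Or.inl ⟨z, hXs (Or.inr hz), rfl⟩
  · exact (Set.image_mono hYs).trans Set.subset_union_left
  · have hz' : ∀ z ∈ X₁ ∪ X₂ ∪ (X₃ ∪ X₄), ψ z ∉ ψ '' (Y₁ ∪ Y₂ ∪ Y₃ ∪ (Y₄ ∪ Y₅)) := by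
      rintro z hz ⟨z', hz', e⟩
      have b1 := hbox _ (hXs hz)
      have b2 := hbox _ (hYs hz')
      have := h.inj _ _ b2.1 b2.2 b1.1 b1.2 e
      subst this
      exact Set.disjoint_left.1 hXY hz hz'
    rw [Set.disjoint_left]
    rintro v ((⟨z, hz, rfl⟩ | rfl | rfl | hv) | ⟨z, hz, rfl⟩)
    · exact hz' z (Or.inl hz)
    · exact hz' _ (Or.inl (Or.inr hpX))
    · exact hz' _ (Or.inr (Or.inl hqX))
    · exact fun hv' => Set.disjoint_left.1 hd hv (Set.image_mono hYs hv')
    · exact hz' z (Or.inr hz)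
  · refine ⟨ψ (ρ, c ρ - 1), Or.inl (Or.inl ⟨_, Or.inr ?_, rfl⟩), ψ (ρ, c ρ),
      ⟨_, Or.inl (Or.inr ?_), rfl⟩, ?_⟩
    · exact ⟨by simp only; omega, by simp only; omega, by simp only; omega, le_rfl⟩
    · exact ⟨by simp only; omega, by simp only; omega, le_rfl, le_rfl⟩
    · exact h.adj _ _ (by simp only; omega) (by simp only; omega) (by simp only; omega)
        (by simp only; omega) (Or.inl ⟨rfl, Or.inl (by simp only; omega)⟩)
  · exact Or.inl (Or.inl ⟨_, Or.inl ⟨rfl, le_rfl, hy₀⟩, rfl⟩)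
  · exact Or.inr ⟨_, Or.inr ⟨rfl, hby, le_rfl⟩, rfl⟩
  · exact ⟨_, Or.inl (Or.inl (Or.inl ⟨rfl, le_rfl, hx₀⟩)), rfl⟩
  · exact ⟨_, Or.inr (Or.inr ⟨rfl, hbx, le_rfl⟩), rfl⟩

end Grid

section Cross

variable {V : Type*} {U : SimpleGraph V} {L : ℕ} {d : ℕ → ℕ → Bool} {ψ : ℕ × ℕ → V}

theorem image_crossSet_swap (ψ : ℕ × ℕ → V) (x₀ x₁ y₀ y₁ a b a' b' ρ κ : ℕ) :
    (fun p : ℕ × ℕ => ψ p.swap) '' crossSet y₀ y₁ x₀ x₁ a' b' a b κ ρ =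
      ψ '' crossSet x₀ x₁ y₀ y₁ a b a' b' ρ κ := by
  ext v
  constructor
  · rintro ⟨⟨x, y⟩, h, rfl⟩
    refine ⟨(y, x), ?_, rfl⟩
    unfold crossSet at *
    simp only [Set.mem_ofPred_eq] at *
    omega
  · rintro ⟨⟨x, y⟩, h, rfl⟩
    refine ⟨(y, x), ?_, rfl⟩
    unfold crossSet at *
    simp only [Set.mem_ofPred_eq] at *
    omega

/-- An ear joining two columns at distance at least two makes the row and the column cross. -/
theorem GridEmb.crosses_of_far (h : GridEmb U L d ψ)
    {x₀ x₁ y₀ y₁ a b a' b' ρ κ : ℕ} (hx₀ : x₀ ≤ a) (haρ : a < ρ) (hρb : ρ < b) (hbx : b ≤ x₁)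
    (hx₁ : x₁ < L) (hy₀ : y₀ ≤ a') (haκ : a' < κ) (hκb : κ < b') (hby : b' ≤ y₁) (hy₁ : y₁ < L)
    {p q : ℕ × ℕ} (hp : a < p.1 ∧ p.1 < b ∧ a' < p.2 ∧ p.2 < b')
    (hq : a < q.1 ∧ q.1 < b ∧ a' < q.2 ∧ q.2 < b') (hpq : p.2 + 2 ≤ q.2 ∨ q.2 + 2 ≤ p.2)
    {E : Set V} (hE : ConnOn U (insert (ψ p) (insert (ψ q) E)))
    (hd : Disjoint E (ψ '' crossSet x₀ x₁ y₀ y₁ a b a' b' ρ κ)) :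
    Crosses U (ψ '' crossSet x₀ x₁ y₀ y₁ a b a' b' ρ κ ∪ E)
      (ψ (ρ, y₀)) (ψ (ρ, y₁)) (ψ (x₀, κ)) (ψ (x₁, κ)) := by
  wlog hlt : p.2 + 2 ≤ q.2 generalizing p q
  · exact this hq hp hpq.symm (by rwa [Set.insert_comm]) (by omega)
  exact h.crosses_of_separator hx₀ haρ hρb hbx hx₁ hy₀ haκ hκb hby hy₁ (fun _ => p.2 + 1)
    (fun r _ _ => by omega) (fun r _ _ => Or.inr (Or.inl ⟨rfl, Or.inl rfl⟩))
    (by omega) (by omega) hE hd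

/-- An ear joining two nonadjacent positions inside the square makes the row and the column
cross. -/
theorem GridEmb.crosses_of_ear (h : GridEmb U L d ψ)
    {x₀ x₁ y₀ y₁ a b a' b' ρ κ : ℕ} (hx₀ : x₀ ≤ a) (haρ : a < ρ) (hρb : ρ < b) (hbx : b ≤ x₁)
    (hx₁ : x₁ < L) (hy₀ : y₀ ≤ a') (haκ : a' < κ) (hκb : κ < b') (hby : b' ≤ y₁) (hy₁ : y₁ < L)
    {p q : ℕ × ℕ} (hp : a < p.1 ∧ p.1 < b ∧ a' < p.2 ∧ p.2 < b')
    (hq : a < q.1 ∧ q.1 < b ∧ a' < q.2 ∧ q.2 < b') (hne : p ≠ q) (hpq : ¬ TAdj d p q)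
    {E : Set V} (hE : ConnOn U (insert (ψ p) (insert (ψ q) E)))
    (hd : Disjoint E (ψ '' crossSet x₀ x₁ y₀ y₁ a b a' b' ρ κ)) :
    Crosses U (ψ '' crossSet x₀ x₁ y₀ y₁ a b a' b' ρ κ ∪ E)
      (ψ (ρ, y₀)) (ψ (ρ, y₁)) (ψ (x₀, κ)) (ψ (x₁, κ)) := by
  by_cases h2 : p.2 + 2 ≤ q.2 ∨ q.2 + 2 ≤ p.2
  · exact h.crosses_of_far hx₀ haρ hρb hbx hx₁ hy₀ haκ hκb hby hy₁ hp hq h2 hE hd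
  by_cases h1 : p.1 + 2 ≤ q.1 ∨ q.1 + 2 ≤ p.1
  · have key := h.swap.crosses_of_far (p := p.swap) (q := q.swap) (E := E) hy₀ haκ hκb hby hy₁
      hx₀ haρ hρb hbx hx₁ (by simp only [Prod.fst_swap, Prod.snd_swap]; omega)
      (by simp only [Prod.fst_swap, Prod.snd_swap]; omega) h1
      (by simpa only [Prod.swap_swap] using hE) (by rwa [image_crossSet_swap])
    rw [image_crossSet_swap] at key
    exact key.symm
  wlog hlt : p.1 ≤ q.1 generalizing p q
  · exact this hq hp hne.symm (fun h => hpq h.symm) (by rwa [Set.insert_comm]) (by omega)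
      (by omega) (by omega)
  obtain ⟨p₁, p₂⟩ := p
  obtain ⟨q₁, q₂⟩ := q
  simp only [TAdj, Prod.mk.injEq, ne_eq] at *
  have hq₁ : q₁ = p₁ + 1 := by omega
  subst hq₁
  rcases Nat.lt_trichotomy p₂ q₂ with hlt | heq | hgt
  · have hq₂ : q₂ = p₂ + 1 := by omega
    subst hq₂
    have hdf : d p₁ p₂ = false := by
      cases hdd : d p₁ p₂
      · rfl
      · simp [hdd] at hpq
    refine h.crosses_of_separator hx₀ haρ hρb hbx hx₁ hy₀ haκ hκb hby hy₁
      (fun r => if r ≤ p₁ then p₂ + 1 else p₂) (fun r _ _ => by split_ifs <;> omega) ?_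
      (p := (p₁, p₂)) (q := (p₁ + 1, p₂ + 1))
      (by simp; omega) (by simp; omega) hE hd
    intro r _ _
    rcases Nat.lt_trichotomy r p₁ with h3 | h3 | h3
    · rw [if_pos (by omega), if_pos (by omega)]
      exact Or.inr (Or.inl ⟨rfl, Or.inl rfl⟩)
    · subst h3
      rw [if_pos le_rfl, if_neg (by omega)]
      exact Or.inr (Or.inr (Or.inr (Or.inr (Or.inl ⟨rfl, rfl, hdf⟩))))
    · rw [if_neg (by omega), if_neg (by omega)]
      exact Or.inr (Or.inl ⟨rfl, Or.inl rfl⟩)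
  · omega
  · have hp₂ : p₂ = q₂ + 1 := by omega
    subst hp₂
    have hdt : d p₁ q₂ = true := by
      cases hdd : d p₁ q₂
      · simp [hdd] at hpq
      · rfl
    refine h.crosses_of_separator hx₀ haρ hρb hbx hx₁ hy₀ haκ hκb hby hy₁
      (fun r => if r ≤ p₁ then q₂ else q₂ + 1) (fun r _ _ => by split_ifs <;> omega) ?_
      (p := (p₁ + 1, q₂)) (q := (p₁, q₂ + 1))
      (by simp; omega) (by simp; omega) (by rwa [Set.insert_comm]) hd
    intro r _ _
    rcases Nat.lt_trichotomy r p₁ with h3 | h3 | h3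
    · rw [if_pos (by omega), if_pos (by omega)]
      exact Or.inr (Or.inl ⟨rfl, Or.inl rfl⟩)
    · subst h3
      rw [if_pos le_rfl, if_neg (by omega)]
      exact Or.inr (Or.inr (Or.inl ⟨rfl, rfl, hdt⟩))
    · rw [if_neg (by omega), if_neg (by omega)]
      exact Or.inr (Or.inl ⟨rfl, Or.inl rfl⟩)

end Cross

section Gadget

variable {V : Type*} {U : SimpleGraph V} {L : ℕ} {d₁ d₂ : ℕ → ℕ → Bool} {ψ₁ ψ₂ : ℕ × ℕ → V}

/-- If consecutive visits of the sequence `u` to `ψ '' K` are never far apart, and `u` has just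
enough time to get from `a` to `c`, then all its members lie in `ψ '' K`, at the expected
height. -/
theorem trace_height {ψ : ℕ × ℕ → V} {K : Set (ℕ × ℕ)} (hinj : Set.InjOn ψ K) (f : ℕ × ℕ → ℕ)
    (u : ℕ → V) (n : ℕ) {a c : ℕ × ℕ} (ha : a ∈ K) (hc : c ∈ K) (h0 : u 0 = ψ a) (hn : u n = ψ c)
    (hf : f c = f a + n)
    (hcons : ∀ m m', m < m' → m' ≤ n → ∀ x ∈ K, ∀ y ∈ K, u m = ψ x → u m' = ψ y →
      (∀ l, m < l → l < m' → ∀ z ∈ K, u l ≠ ψ z) → f y ≤ f x + 1) :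
    ∀ m ≤ n, ∃ x ∈ K, u m = ψ x ∧ f x = f a + m := by
  have key : ∀ m ≤ n, ∃ m' ≤ m, ∃ x ∈ K, u m' = ψ x ∧ (∀ l, m' < l → l ≤ m → ∀ z ∈ K, u l ≠ ψ z) ∧
      ((f x = f a + m' ∧ ∀ l ≤ m', ∃ y ∈ K, u l = ψ y ∧ f y = f a + l) ∨ f x < f a + m') := by
    intro m
    induction m with
    | zero =>
      refine fun _ => ⟨0, le_rfl, a, ha, h0, fun l h1 h2 => by omega, Or.inl ⟨rfl, ?_⟩⟩
      intro l hl
      obtain rfl : l = 0 := by omega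
      exact ⟨a, ha, h0, rfl⟩
    | succ m ih =>
      intro hm
      obtain ⟨m', hm', x, hx, hux, hno, hcase⟩ := ih (by omega)
      by_cases hhit : ∃ y ∈ K, u (m + 1) = ψ y
      · obtain ⟨y, hy, huy⟩ := hhit
        have hle := hcons m' (m + 1) (by omega) hm x hx y hy hux huy
          (fun l h1 h2 => hno l h1 (by omega))
        refine ⟨m + 1, le_rfl, y, hy, huy, fun l h1 h2 => by omega, ?_⟩
        by_cases hlt : f y < f a + (m + 1)
        · exact Or.inr hlt
        rcases hcase with ⟨hfx, hall⟩ | hlt'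
        · have hmm : m' = m := by omega
          subst hmm
          have hfy : f y = f a + (m' + 1) := by omega
          refine Or.inl ⟨hfy, fun l hl => ?_⟩
          rcases Nat.lt_or_ge m' l with h | h
          · obtain rfl : l = m' + 1 := by omega
            exact ⟨y, hy, huy, hfy⟩
          · exact hall l h
        · omega
      · push Not at hhit
        refine ⟨m', by omega, x, hx, hux, fun l h1 h2 => ?_, hcase⟩
        rcases Nat.lt_or_ge m l with h | h
        · obtain rfl : l = m + 1 := by omega
          exact hhit
        · exact hno l h1 h
  obtain ⟨m', hm', x, hx, hux, hno, hcase⟩ := key n le_rfl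
  have hmn : m' = n := by
    by_contra hne
    exact hno n (by omega) le_rfl c hc hn
  subst hmn
  have hxc : x = c := hinj hx hc (hux.symm.trans hn)
  subst hxc
  rcases hcase with ⟨_, hall⟩ | hlt
  · exact hall
  · omega

/-- The square of a block with origin `(ox, oy)`: offsets between `A - k` and `H + k`. -/
def blockSq (ox oy A H k : ℕ) : Set (ℕ × ℕ) :=
  {z | ox + A ≤ z.1 + k ∧ z.1 ≤ ox + H + k ∧ oy + A ≤ z.2 + k ∧ z.2 ≤ oy + H + k}

/-- The ear `ψ₂ '' P`, running inside offsets `[A, A + β)` of the block with origin `(ox, oy)`,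
joins two `d₁`-nonadjacent positions inside a square of the block without meeting that square. -/
def IsGadget (U : SimpleGraph V) (d₁ : ℕ → ℕ → Bool) (ψ₁ ψ₂ : ℕ × ℕ → V) (ox oy A H β : ℕ)
    (P : Finset (ℕ × ℕ)) : Prop :=
  P.card ≤ β ∧
  (∀ z ∈ P, ox + A ≤ z.1 ∧ z.1 < ox + A + β ∧ oy + A ≤ z.2 ∧ z.2 < oy + A + β) ∧
  ∃ k, 1 ≤ k ∧ k ≤ β + 1 ∧ ∃ p q : ℕ × ℕ,
    (ox + A < p.1 + k ∧ p.1 < ox + H + k ∧ oy + A < p.2 + k ∧ p.2 < oy + H + k) ∧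
    (ox + A < q.1 + k ∧ q.1 < ox + H + k ∧ oy + A < q.2 + k ∧ q.2 < oy + H + k) ∧
    p ≠ q ∧ ¬ TAdj d₁ p q ∧ ConnOn U (insert (ψ₁ p) (insert (ψ₁ q) (ψ₂ '' P))) ∧
    ∀ z ∈ P, ∀ z' ∈ blockSq ox oy A H k, ψ₂ z ≠ ψ₁ z'

theorem IsGadget.swap {ox oy A H β : ℕ} {P : Finset (ℕ × ℕ)}
    (h : IsGadget U (fun x y => d₁ y x) (fun p : ℕ × ℕ => ψ₁ p.swap)
      (fun p : ℕ × ℕ => ψ₂ p.swap) oy ox A H β P) :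
    IsGadget U d₁ ψ₁ ψ₂ ox oy A H β (P.map (Equiv.prodComm ℕ ℕ).toEmbedding) := by
  obtain ⟨h1, h2, k, hk1, hk2, p, q, hp, hq, hne, hadj, hconn, hd⟩ := h
  have himg : ψ₂ '' (P.map (Equiv.prodComm ℕ ℕ).toEmbedding) =
      (fun p : ℕ × ℕ => ψ₂ p.swap) '' P := by
    ext v
    simp only [Set.mem_image, Finset.coe_map, Prod.exists, Prod.swap_prod_mk]
    constructor
    · rintro ⟨a, b, ⟨x, y, h, e⟩, rfl⟩
      obtain ⟨rfl, rfl⟩ : y = a ∧ x = b := by simpa using e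
      exact ⟨_, _, h, rfl⟩
    · rintro ⟨a, b, h, rfl⟩
      exact ⟨_, _, ⟨a, b, h, rfl⟩, rfl⟩
  refine ⟨by simpa using h1, ?_, k, hk1, hk2, p.swap, q.swap, ?_, ?_, ?_, ?_, ?_, ?_⟩
  · intro z hz
    rw [Finset.mem_map] at hz
    obtain ⟨y, hy, rfl⟩ := hz
    have := h2 y hy
    simp only [Equiv.coe_toEmbedding, Equiv.prodComm_apply, Prod.fst_swap, Prod.snd_swap]
    omega
  · simp only [Prod.fst_swap, Prod.snd_swap]
    omega
  · simp only [Prod.fst_swap, Prod.snd_swap]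
    omega
  · exact fun e => hne (Prod.swap_injective e)
  · exact fun e => hadj (by simpa using e.swap)
  · rw [himg]
    exact hconn
  · intro z hz z' hz'
    rw [Finset.mem_map] at hz
    obtain ⟨y, hy, rfl⟩ := hz
    refine hd y hy z'.swap ?_
    simp only [blockSq, Set.mem_ofPred_eq, Prod.fst_swap, Prod.snd_swap] at hz' ⊢
    omega

/-- Between two positions of a row at which `ψ₁` and `ψ₂` agree, the embedding `ψ₂` follows `ψ₁`
up to the row index, unless there is a gadget. -/
theorem row_agree (h₁ : GridEmb U L d₁ ψ₁) (h₂ : GridEmb U L d₂ ψ₂) {ox oy A H β : ℕ}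
    (hH : A + β ≤ H) (hox : ox + H + β + 1 < L) (hoy : oy + H + β + 1 < L)
    (hno : ∀ P, ¬ IsGadget U d₁ ψ₁ ψ₂ ox oy A H β P) {i j₀ j₁ : ℕ}
    (hi : ox + A ≤ i ∧ i < ox + A + β) (hj₀ : oy + A ≤ j₀) (hj : j₀ ≤ j₁) (hj₁ : j₁ < oy + A + β)
    (e₀ : ψ₁ (i, j₀) = ψ₂ (i, j₀)) (e₁ : ψ₁ (i, j₁) = ψ₂ (i, j₁)) {j : ℕ} (hj0 : j₀ ≤ j)
    (hj1 : j ≤ j₁) : ∃ r < L, ψ₂ (i, j) = ψ₁ (r, j) := by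
  obtain ⟨k, hk1, hk2, hring⟩ : ∃ k, 1 ≤ k ∧ k ≤ β + 1 ∧ ∀ l, j₀ ≤ l → l ≤ j₁ →
      ∀ z ∈ blockSq ox oy A H k, ψ₂ (i, l) = ψ₁ z →
        ox + A < z.1 + k ∧ z.1 < ox + H + k ∧ oy + A < z.2 + k ∧ z.2 < oy + H + k := by
    by_contra! hcon
    have hcon' : ∀ k ∈ Finset.Icc 1 (β + 1), ∃ l ∈ Finset.Icc j₀ j₁, ∃ z ∈ blockSq ox oy A H k,
        ψ₂ (i, l) = ψ₁ z ∧
        ¬ (ox + A < z.1 + k ∧ z.1 < ox + H + k ∧ oy + A < z.2 + k ∧ z.2 < oy + H + k) := by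
      intro k hk
      rw [Finset.mem_Icc] at hk
      obtain ⟨l, h1, h2, z, hz, he, h3⟩ := hcon k hk.1 hk.2
      exact ⟨l, Finset.mem_Icc.2 ⟨h1, h2⟩, z, hz, he, fun h => by omega⟩
    choose! l hl z hz he hr using hcon'
    obtain ⟨k, hk, k', hk', hne, hll⟩ := Finset.exists_ne_map_eq_of_card_lt_of_maps_to
      (s := Finset.Icc 1 (β + 1)) (t := Finset.Icc j₀ j₁) (by simp; omega) hl
    have e := (he k hk).symm.trans ((congrArg (fun l => ψ₂ (i, l)) hll).trans (he k' hk'))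
    have a1 := hz k hk
    have a2 := hz k' hk'
    have b1 := hr k hk
    have b2 := hr k' hk'
    rw [Finset.mem_Icc] at hk hk'
    simp only [blockSq, Set.mem_ofPred_eq] at a1 a2
    have := h₁.inj _ _ (by omega) (by omega) (by omega) (by omega) e
    rw [this] at a1 b1
    omega
  have hinj : Set.InjOn ψ₁ (blockSq ox oy A H k) := by
    intro x hx y hy e
    simp only [blockSq, Set.mem_ofPred_eq] at hx hy
    exact h₁.inj _ _ (by omega) (by omega) (by omega) (by omega) e
  have hmemK : ∀ l, j₀ ≤ l → l ≤ j₁ → (i, l) ∈ blockSq ox oy A H k := fun l _ _ =>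
    ⟨by simp only; omega, by simp only; omega, by simp only; omega, by simp only; omega⟩
  have key := trace_height hinj Prod.snd (fun m => ψ₂ (i, j₀ + m)) (j₁ - j₀)
    (hmemK j₀ le_rfl hj) (hmemK j₁ hj le_rfl) e₀.symm
    (by simp only [Nat.add_sub_cancel' hj]; exact e₁.symm) (by simp only; omega) ?_ (j - j₀)
    (by omega)
  · obtain ⟨⟨r, s⟩, hx, hu, hs⟩ := key
    simp only at hs hu
    rw [Nat.add_sub_cancel' hj0] at hs hu
    subst hs
    simp only [blockSq, Set.mem_ofPred_eq] at hx
    exact ⟨r, by omega, hu⟩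
  · intro m m' hm hm' x hx y hy hux huy hnone
    by_contra hfar
    have hx' := hring (j₀ + m) (by omega) (by omega) x hx hux
    have hy' := hring (j₀ + m') (by omega) (by omega) y hy huy
    refine hno ({i} ×ˢ Finset.Ioo (j₀ + m) (j₀ + m'))
      ⟨?_, ?_, k, hk1, hk2, x, y, hx', hy', ?_, ?_, ?_, ?_⟩
    · simp only [Finset.card_product, Finset.card_singleton, Nat.card_Ioo]
      omega
    · rintro ⟨z, l⟩ hz
      simp only [Finset.mem_product, Finset.mem_singleton, Finset.mem_Ioo] at hz ⊢
      omega
    · rintro rfl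
      omega
    · unfold TAdj
      omega
    · convert h₂.connOn_row (r := i) (c₁ := j₀ + m) (c₂ := j₀ + m') (by omega) (by omega)
        (by omega) using 1
      rw [← hux, ← huy]
      ext v
      simp only [Finset.coe_product, Finset.coe_singleton, Finset.coe_Ioo, Set.mem_insert_iff,
        Set.mem_image, Set.mem_prod, Set.mem_singleton_iff, Set.mem_Ioo, Set.mem_ofPred_eq,
        Prod.exists]
      constructor
      · rintro (rfl | rfl | ⟨a, b, ⟨rfl, h1, h2⟩, rfl⟩)
        · exact ⟨i, j₀ + m, by omega, rfl⟩
        · exact ⟨i, j₀ + m', by omega, rfl⟩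
        · exact ⟨a, b, by omega, rfl⟩
      · rintro ⟨a, b, ⟨rfl, h1, h2⟩, rfl⟩
        by_cases hb : b = j₀ + m
        · exact Or.inl (by rw [hb])
        by_cases hb' : b = j₀ + m'
        · exact Or.inr (Or.inl (by rw [hb']))
        exact Or.inr (Or.inr ⟨a, b, by omega, rfl⟩)
    · rintro ⟨z, l⟩ hz z' hz' e
      simp only [Finset.mem_product, Finset.mem_singleton, Finset.mem_Ioo] at hz
      obtain ⟨rfl, h1, h2⟩ := hz
      refine hnone (l - j₀) (by omega) (by omega) z' hz' ?_
      rwa [Nat.add_sub_cancel' (by omega)]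

/-- Without a gadget, two embeddings that agree around every position of the core of a block
have the same diagonals in the core. -/
theorem diagonals_eq_of_no_gadget (h₁ : GridEmb U L d₁ ψ₁) (h₂ : GridEmb U L d₂ ψ₂)
    {ox oy A H β : ℕ} (hH : A + β ≤ H) (hox : ox + H + β + 1 < L)
    (hoy : oy + H + β + 1 < L) (hno : ∀ P, ¬ IsGadget U d₁ ψ₁ ψ₂ ox oy A H β P)
    {cx cy w : ℕ} (hcx : ox + A ≤ cx ∧ cx + w ≤ ox + A + β)
    (hcy : oy + A ≤ cy ∧ cy + w ≤ oy + A + β)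
    (hrow : ∀ i j, cx ≤ i → i < cx + w → cy ≤ j → j < cy + w → ∃ j₀ j₁, oy + A ≤ j₀ ∧ j₀ ≤ j ∧
      j ≤ j₁ ∧ j₁ < oy + A + β ∧ ψ₁ (i, j₀) = ψ₂ (i, j₀) ∧ ψ₁ (i, j₁) = ψ₂ (i, j₁))
    (hcol : ∀ i j, cx ≤ i → i < cx + w → cy ≤ j → j < cy + w → ∃ i₀ i₁, ox + A ≤ i₀ ∧ i₀ ≤ i ∧
      i ≤ i₁ ∧ i₁ < ox + A + β ∧ ψ₁ (i₀, j) = ψ₂ (i₀, j) ∧ ψ₁ (i₁, j) = ψ₂ (i₁, j))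
    {x y : ℕ} (hx : cx ≤ x ∧ x + 1 < cx + w) (hy : cy ≤ y ∧ y + 1 < cy + w) :
    d₁ x y = d₂ x y := by
  have hagree : ∀ i j, cx ≤ i → i < cx + w → cy ≤ j → j < cy + w → ψ₁ (i, j) = ψ₂ (i, j) := by
    intro i j h1 h2 h3 h4
    obtain ⟨j₀, j₁, a1, a2, a3, a4, a5, a6⟩ := hrow i j h1 h2 h3 h4
    obtain ⟨i₀, i₁, b1, b2, b3, b4, b5, b6⟩ := hcol i j h1 h2 h3 h4
    obtain ⟨r, hr, er⟩ := row_agree h₁ h₂ hH hox hoy hno ⟨by omega, by omega⟩ a1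
      (a2.trans a3) a4 a5 a6 a2 a3
    obtain ⟨s, hs, es⟩ := row_agree h₁.swap h₂.swap hH hoy hox (fun P hP => hno _ hP.swap)
      (i := j) ⟨by omega, by omega⟩ b1 (b2.trans b3) b4 b5 b6 b2 b3
    have := h₁.inj _ _ hr (by simp only; omega) (by simp only [Prod.fst_swap]; omega)
      (by simpa using hs) (er.symm.trans es)
    simp only [Prod.swap_prod_mk, Prod.mk.injEq] at this
    rw [er, this.1]
  by_contra hne
  have gad : ∀ p q : ℕ × ℕ, cx ≤ p.1 → p.1 < cx + w → cy ≤ p.2 → p.2 < cy + w → cx ≤ q.1 →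
      q.1 < cx + w → cy ≤ q.2 → q.2 < cy + w → p ≠ q → TAdj d₂ p q → ¬ TAdj d₁ p q → False := by
    intro p q p1 p2 p3 p4 q1 q2 q3 q4 hpq t2 t1
    refine hno ∅ ⟨by simp, by simp, 1, le_rfl, by omega, p, q, by omega, by omega, hpq, t1, ?_,
      by simp⟩
    have e := h₂.adj p q (by omega) (by omega) (by omega) (by omega) t2
    rw [← hagree p.1 p.2 p1 p2 p3 p4, ← hagree q.1 q.2 q1 q2 q3 q4] at e
    have hc : ConnOn U {ψ₁ p, ψ₁ q} := induce_pair_connected_of_adj e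
    simpa using hc
  cases hd : d₂ x y with
  | true =>
    have hd' : d₁ x y = false := by simpa [hd] using hne
    refine gad (x, y) (x + 1, y + 1) ?_ ?_ ?_ ?_ ?_ ?_ ?_ ?_ ?_ ?_ ?_ <;>
      simp [TAdj, hd, hd'] <;> omega
  | false =>
    have hd' : d₁ x y = true := by simpa [hd] using hne
    refine gad (x + 1, y) (x, y + 1) ?_ ?_ ?_ ?_ ?_ ?_ ?_ ?_ ?_ ?_ ?_ <;>
      simp [TAdj, hd, hd'] <;> omega

end Gadget

section Assembly

/-- Averaging over a family of bijections. -/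
theorem card_mul_card_filter_le {Ω A : Type*} [Fintype Ω] [Fintype A] (Φ : A → Ω → Ω)
    (hΦ : ∀ a, Function.Bijective (Φ a)) (P : Ω → Prop) [DecidablePred P] (m : ℕ)
    (hm : ∀ ω, (Finset.univ.filter fun a => P (Φ a ω)).card ≤ m) :
    Fintype.card A * (Finset.univ.filter P).card ≤ m * Fintype.card Ω := by
  have h1 : ∀ a, (Finset.univ.filter P).card = (Finset.univ.filter fun ω => P (Φ a ω)).card := by
    intro a
    symm
    refine Finset.card_bij (fun ω _ => Φ a ω) (by simp) (fun x _ y _ e => (hΦ a).1 e) ?_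
    intro b hb
    obtain ⟨ω, rfl⟩ := (hΦ a).2 b
    exact ⟨ω, by simpa using hb, rfl⟩
  calc Fintype.card A * (Finset.univ.filter P).card
      = ∑ a : A, (Finset.univ.filter fun ω => P (Φ a ω)).card := by
        rw [← Finset.sum_congr rfl (fun a _ => h1 a)]
        simp
    _ = ∑ ω : Ω, (Finset.univ.filter fun a => P (Φ a ω)).card := by
        simp only [Finset.card_filter]
        exact Finset.sum_comm
    _ ≤ ∑ _ω : Ω, m := Finset.sum_le_sum fun ω _ => hm ω
    _ = m * Fintype.card Ω := by simp [mul_comm]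

/-- Selecting one row in each of `t` strips and one column in each of `t` strips such that no
selected position is bad and no selected position hits another one. -/
theorem exists_selection {t β : ℕ} {R : Type*} [Fintype R] [AddCommGroup R] [DecidableEq R]
    (Bad : Finset ((Fin t × R) × (Fin t × R)))
    (Hit : (Fin t × R) × (Fin t × R) → Finset ((Fin t × R) × (Fin t × R)))
    (hBad : 2 * Bad.card < Fintype.card R ^ 2) (hHit : ∀ b, (Hit b).card ≤ β)
    (hR : 2 * (t ^ 4 * β) ≤ Fintype.card R) :
    ∃ s u : Fin t → R, (∀ i j, ((i, s i), (j, u j)) ∉ Bad) ∧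
      ∀ i j i' j', (i, j) ≠ (i', j') →
        ((i', s i'), (j', u j')) ∉ Hit ((i, s i), (j, u j)) := by
  classical
  set g := Fintype.card R with hg
  let Ω := (Fin t → R) × (Fin t → R)
  by_contra! hcon
  let B1 : Fin t × Fin t → Finset Ω := fun x =>
    Finset.univ.filter fun ω => ((x.1, ω.1 x.1), (x.2, ω.2 x.2)) ∈ Bad
  let B2 : (Fin t × Fin t) × (Fin t × Fin t) → Finset Ω := fun x =>
    Finset.univ.filter fun ω => x.1 ≠ x.2 ∧ ((x.2.1, ω.1 x.2.1), (x.2.2, ω.2 x.2.2)) ∈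
      Hit ((x.1.1, ω.1 x.1.1), (x.1.2, ω.2 x.1.2))
  have hcover : (Finset.univ : Finset Ω) ⊆ Finset.univ.biUnion B1 ∪ Finset.univ.biUnion B2 := by
    rintro ⟨s, u⟩ -
    rw [Finset.mem_union, Finset.mem_biUnion, Finset.mem_biUnion]
    by_cases h : ∀ i j, ((i, s i), (j, u j)) ∉ Bad
    · obtain ⟨i, j, i', j', hne, hh⟩ := hcon s u h
      exact Or.inr ⟨((i, j), (i', j')), Finset.mem_univ _,
        by simpa [B2] using ⟨by simpa using hne, hh⟩⟩
    · push Not at h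
      obtain ⟨i, j, h⟩ := h
      exact Or.inl ⟨(i, j), Finset.mem_univ _, by simpa [B1] using h⟩
  have hcard : Fintype.card Ω ≤ ∑ x, (B1 x).card + ∑ x, (B2 x).card := by
    calc Fintype.card Ω = (Finset.univ : Finset Ω).card := rfl
      _ ≤ _ := Finset.card_le_card hcover
      _ ≤ _ := Finset.card_union_le _ _
      _ ≤ _ := add_le_add Finset.card_biUnion_le Finset.card_biUnion_le
  have h1 : ∀ x, g ^ 2 * (B1 x).card ≤
      (Bad.filter fun b => (b.1.1, b.2.1) = x).card * Fintype.card Ω := by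
    rintro ⟨i, j⟩
    have := card_mul_card_filter_le (Ω := Ω) (A := R × R)
      (fun a ω => (ω.1 + Pi.single i a.1, ω.2 + Pi.single j a.2))
      (fun a => (Equiv.prodCongr (Equiv.addRight (Pi.single i a.1 : Fin t → R))
        (Equiv.addRight (Pi.single j a.2 : Fin t → R))).bijective)
      (fun ω => ((i, ω.1 i), (j, ω.2 j)) ∈ Bad) (Bad.filter fun b => (b.1.1, b.2.1) = (i, j)).card
      (fun ω => ?_)
    · rwa [Fintype.card_prod, ← hg, ← sq] at this
    · refine Finset.card_le_card_of_injOn (fun a => ((i, ω.1 i + a.1), (j, ω.2 j + a.2))) ?_ ?_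
      · intro a ha
        simpa using ha
      · intro a _ b _ e
        simpa [Prod.ext_iff] using e
  have h2 : ∀ x, g * (B2 x).card ≤ β * Fintype.card Ω := by
    rintro ⟨⟨i, j⟩, ⟨i', j'⟩⟩
    by_cases hne : (i, j) = (i', j')
    · have : B2 ((i, j), (i', j')) = ∅ := by
        simp [B2, hne]
      simp [this]
    by_cases hi : i = i'
    · have hj : j ≠ j' := fun h => hne (by rw [hi, h])
      refine card_mul_card_filter_le (Ω := Ω) (A := R)
        (fun a ω => (ω.1, ω.2 + Pi.single j' a))
        (fun a => (Equiv.prodCongr (Equiv.refl _)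
          (Equiv.addRight (Pi.single j' a : Fin t → R))).bijective) _ β (fun ω => ?_)
      refine (Finset.card_le_card_of_injOn (fun a => ((i', ω.1 i'), (j', ω.2 j' + a)))
        (t := Hit ((i, ω.1 i), (j, ω.2 j))) ?_ ?_).trans (hHit _)
      · intro a ha
        simpa [hj, hne] using ha
      · intro a _ b _ e
        simpa [Prod.ext_iff] using e
    · refine card_mul_card_filter_le (Ω := Ω) (A := R)
        (fun a ω => (ω.1 + Pi.single i' a, ω.2))
        (fun a => (Equiv.prodCongr (Equiv.addRight (Pi.single i' a : Fin t → R))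
          (Equiv.refl _)).bijective) _ β (fun ω => ?_)
      refine (Finset.card_le_card_of_injOn (fun a => ((i', ω.1 i' + a), (j', ω.2 j')))
        (t := Hit ((i, ω.1 i), (j, ω.2 j))) ?_ ?_).trans (hHit _)
      · intro a ha
        simpa [hi, hne] using ha
      · intro a _ b _ e
        simpa [Prod.ext_iff] using e
  have s1 : g ^ 2 * ∑ x, (B1 x).card ≤ Bad.card * Fintype.card Ω := by
    rw [Finset.mul_sum, Finset.card_eq_sum_card_fiberwise (f := fun b => (b.1.1, b.2.1))
      (s := Bad) (t := Finset.univ) (fun _ _ => Finset.mem_univ _), Finset.sum_mul]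
    exact Finset.sum_le_sum fun x _ => h1 x
  have s2 : g * ∑ x, (B2 x).card ≤ t ^ 4 * β * Fintype.card Ω := by
    rw [Finset.mul_sum]
    refine (Finset.sum_le_sum fun x _ => h2 x).trans (le_of_eq ?_)
    simp
    ring
  have hΩ : 0 < Fintype.card Ω := Fintype.card_pos
  nlinarith [Nat.mul_le_mul_left (g ^ 2) hcard, Nat.mul_le_mul_left g s2,
    Nat.mul_le_mul_right (g * Fintype.card Ω) hR, Nat.mul_lt_mul_of_pos_right hBad hΩ]

variable {V : Type*} {U : SimpleGraph V} {L : ℕ} {d₁ d₂ : ℕ → ℕ → Bool} {ψ₁ ψ₂ : ℕ × ℕ → V}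

/-- A line in a wide band avoiding few vertices. -/
theorem exists_clear_line {ψ₁ ψ₂ : ℕ × ℕ → V} {Z : Finset (ℕ × ℕ)} {K : Set (ℕ × ℕ)}
    (hinj : Set.InjOn ψ₁ K) (f : ℕ × ℕ → ℕ) (lo : ℕ) {m : ℕ} (hZ : Z.card ≤ m) :
    ∃ ρ, lo ≤ ρ ∧ ρ ≤ lo + m ∧ ∀ z ∈ Z, ∀ z' ∈ K, f z' = ρ → ψ₂ z ≠ ψ₁ z' := by
  by_contra! hcon
  have hcon' : ∀ ρ ∈ Finset.Icc lo (lo + m), ∃ z ∈ Z, ∃ z' ∈ K, f z' = ρ ∧ ψ₂ z = ψ₁ z' := by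
    intro ρ hρ
    rw [Finset.mem_Icc] at hρ
    exact hcon ρ hρ.1 hρ.2
  choose! z hz z' hz' hf he using hcon'
  obtain ⟨k, hk, k', hk', hne, hkk⟩ := Finset.exists_ne_map_eq_of_card_lt_of_maps_to
    (s := Finset.Icc lo (lo + m)) (t := Z) (by simp; omega) hz
  have e := (he k hk).symm.trans ((congrArg ψ₂ hkk).trans (he k' hk'))
  have := hinj (hz' k hk) (hz' k' hk') e
  exact hne (by rw [← hf k hk, ← hf k' hk', this])

/-- A `t × t` array of gadgets, no gadget meeting the period of another one, yields a
`K_t`-minor. -/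
theorem hasMinor_of_gadgets (h₁ : GridEmb U L d₁ ψ₁) (h₂ : GridEmb U L d₂ ψ₂)
    {t G A H β : ℕ} (hA : β + 1 ≤ A) (hH : A + β ≤ H) (hHt : A + t * t * β ≤ H)
    (hG : H + β + 1 < G) (x₀ y₀ : ℕ → ℕ) (hx₀ : Monotone x₀) (hy₀ : Monotone y₀)
    (hxL : x₀ t ≤ L) (hyL : y₀ t ≤ L) (px py : Fin t → ℕ)
    (hpx : ∀ i : Fin t, x₀ i ≤ px i ∧ px i + G ≤ x₀ (i + 1))
    (hpy : ∀ j : Fin t, y₀ j ≤ py j ∧ py j + G ≤ y₀ (j + 1))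
    (P : Fin t → Fin t → Finset (ℕ × ℕ))
    (hP : ∀ i j, IsGadget U d₁ ψ₁ ψ₂ (px i) (py j) A H β (P i j))
    (hhit : ∀ i j i' j', (i, j) ≠ (i', j') → ∀ z ∈ P i j, ∀ z' : ℕ × ℕ, px i' ≤ z'.1 →
      z'.1 < px i' + G → py j' ≤ z'.2 → z'.2 < py j' + G → ψ₂ z ≠ ψ₁ z') :
    U.HasMinor (⊤ : SimpleGraph (Fin t)) := by
  classical
  have hxt : ∀ i : Fin t, x₀ (i + 1) ≤ L := fun i => (hx₀ (by omega)).trans hxL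
  have hyt : ∀ i : Fin t, y₀ (i + 1) ≤ L := fun i => (hy₀ (by omega)).trans hyL
  have hxx : ∀ i i' : Fin t, i < i' → x₀ (i + 1) ≤ x₀ i' := fun i i' h => hx₀ (by omega)
  have hyy : ∀ i i' : Fin t, i < i' → y₀ (i + 1) ≤ y₀ i' := fun i i' h => hy₀ (by omega)
  have hinj : Set.InjOn ψ₁ {z | z.1 < L ∧ z.2 < L} :=
    fun x hx y hy e => h₁.inj _ _ hx.1 hx.2 hy.1 hy.2 e
  let Z : Finset (ℕ × ℕ) := Finset.univ.biUnion fun x : Fin t × Fin t => P x.1 x.2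
  have hZ : Z.card ≤ t * t * β := by
    refine Finset.card_biUnion_le.trans ((Finset.sum_le_card_nsmul _ _ β
      (fun x _ => (hP x.1 x.2).1)).trans ?_)
    simp
  have hPZ : ∀ i j, ∀ z ∈ P i j, z ∈ Z := fun i j z hz =>
    Finset.mem_biUnion.2 ⟨(i, j), Finset.mem_univ _, hz⟩
  choose ρ hρ₁ hρ₂ hρ using fun i : Fin t =>
    exists_clear_line (ψ₂ := ψ₂) hinj Prod.fst (px i + A) hZ
  choose κ hκ₁ hκ₂ hκ using fun j : Fin t =>
    exists_clear_line (ψ₂ := ψ₂) hinj Prod.snd (py j + A) hZ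
  choose hcard hPb k hk₁ hk₂ p q hp hq hne hadj hconn hd using hP
  let Cl : Fin t → Fin t → Set (ℕ × ℕ) := fun i j =>
    crossSet (x₀ i) (x₀ (i + 1) - 1) (y₀ j) (y₀ (j + 1) - 1) (px i + A - k i j)
      (px i + H + k i j) (py j + A - k i j) (py j + H + k i j) (ρ i) (κ j)
  let E : Fin t → Fin t → Set V := fun i j => ψ₂ '' P i j
  have hClbox : ∀ i j, ∀ z ∈ Cl i j, x₀ i ≤ z.1 ∧ z.1 < x₀ (i + 1) ∧ y₀ j ≤ z.2 ∧
      z.2 < y₀ (j + 1) := by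
    intro i j z hz
    have a1 := hpx i
    have a2 := hpy j
    have a3 := hρ₁ i
    have a4 := hρ₂ i
    have a5 := hκ₁ j
    have a6 := hκ₂ j
    have a7 := hk₁ i j
    have a8 := hk₂ i j
    simp only [Cl, crossSet, Set.mem_ofPred_eq] at hz
    omega
  have hECl : ∀ i j i' j', Disjoint (E i j) (ψ₁ '' Cl i' j') := by
    intro i j i' j'
    rw [Set.disjoint_left]
    rintro _ ⟨z, hz, rfl⟩ ⟨z', hz', e⟩
    have hbox := hClbox i' j' z' hz'
    have hL : z' ∈ {z : ℕ × ℕ | z.1 < L ∧ z.2 < L} :=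
      ⟨by have := hxt i'; omega, by have := hyt j'; omega⟩
    rcases hz' with hz' | hz' | hz'
    · have a7 := hk₁ i' j'
      have a8 := hk₂ i' j'
      have a1 := hpx i'
      have a2 := hpy j'
      by_cases hij : (i, j) = (i', j')
      · obtain ⟨rfl, rfl⟩ := Prod.mk.inj hij
        refine hd i j z hz z' ?_ e.symm
        simp only [blockSq, Set.mem_ofPred_eq]
        omega
      · exact hhit i j i' j' hij z hz z' (by omega) (by omega) (by omega) (by omega) e.symm
    · exact hρ i' z (hPZ _ _ z hz) z' hL hz'.1 e.symm
    · exact hκ j' z (hPZ _ _ z hz) z' hL hz'.1 e.symm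
  have hcross : ∀ i j, Crosses U (ψ₁ '' Cl i j ∪ E i j) (ψ₁ (ρ i, y₀ j))
      (ψ₁ (ρ i, y₀ (j + 1) - 1)) (ψ₁ (x₀ i, κ j)) (ψ₁ (x₀ (i + 1) - 1, κ j)) := by
    intro i j
    have a1 := hpx i
    have a2 := hpy j
    have a3 := hρ₁ i
    have a4 := hρ₂ i
    have a5 := hκ₁ j
    have a6 := hκ₂ j
    have a7 := hk₁ i j
    have a8 := hk₂ i j
    have a9 := hp i j
    have b1 := hq i j
    have b2 := hxt i
    have b3 := hyt j
    exact h₁.crosses_of_ear (by omega) (by omega) (by omega) (by omega) (by omega) (by omega)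
      (by omega) (by omega) (by omega) (by omega) (by omega) (by omega) (hne i j) (hadj i j)
      (hconn i j) (hECl i j i j)
  have hdis : ∀ i j i' j', (i, j) ≠ (i', j') →
      Disjoint (ψ₁ '' Cl i j ∪ E i j) (ψ₁ '' Cl i' j' ∪ E i' j') := by
    intro i j i' j' hij
    have hsep : ∀ z z' : ℕ × ℕ, x₀ i ≤ z.1 → z.1 < x₀ (i + 1) → y₀ j ≤ z.2 →
        z.2 < y₀ (j + 1) → x₀ i' ≤ z'.1 → z'.1 < x₀ (i' + 1) → y₀ j' ≤ z'.2 →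
        z'.2 < y₀ (j' + 1) → z ≠ z' := by
      rintro z z' c1 c2 c3 c4 c5 c6 c7 c8 rfl
      apply hij
      have e1 : i = i' := by
        rcases lt_trichotomy i i' with h | h | h
        · have := hxx _ _ h
          omega
        · exact h
        · have := hxx _ _ h
          omega
      have e2 : j = j' := by
        rcases lt_trichotomy j j' with h | h | h
        · have := hyy _ _ h
          omega
        · exact h
        · have := hyy _ _ h
          omega
      rw [e1, e2]
    rw [Set.disjoint_union_left, Set.disjoint_union_right, Set.disjoint_union_right]
    refine ⟨⟨?_, (hECl _ _ _ _).symm⟩, hECl _ _ _ _, ?_⟩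
    · rw [Set.disjoint_left]
      rintro _ ⟨z, hz, rfl⟩ ⟨z', hz', e⟩
      have c1 := hClbox _ _ _ hz
      have c2 := hClbox _ _ _ hz'
      have c3 := hxt i
      have c4 := hxt i'
      have c5 := hyt j
      have c6 := hyt j'
      exact hsep z z' c1.1 c1.2.1 c1.2.2.1 c1.2.2.2 c2.1 c2.2.1 c2.2.2.1 c2.2.2.2
        (h₁.inj _ _ (by omega) (by omega) (by omega) (by omega) e).symm
    · rw [Set.disjoint_left]
      rintro _ ⟨z, hz, rfl⟩ ⟨z', hz', e⟩
      have c1 := hPb _ _ _ hz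
      have c2 := hPb _ _ _ hz'
      have c3 := hxt i
      have c4 := hxt i'
      have c5 := hyt j
      have c6 := hyt j'
      have a1 := hpx i
      have a2 := hpy j
      have a3 := hpx i'
      have a4 := hpy j'
      exact hsep z z' (by omega) (by omega) (by omega) (by omega) (by omega) (by omega)
        (by omega) (by omega) (h₂.inj _ _ (by omega) (by omega) (by omega) (by omega) e).symm
  choose X Y hX hY cX cY dXY lXY hl hr hu hlow using hcross
  refine hasMinor_of_array X Y cX cY ?_ ?_ lXY ?_ ?_ ?_
  · intro i j j' hjj
    refine ⟨_, hr i j, _, hl i j', h₁.adj _ _ ?_ ?_ ?_ ?_ (Or.inl ⟨rfl, Or.inl ?_⟩)⟩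
    all_goals
      have a1 := hpx i
      have a2 := hpy j
      have a3 := hpy j'
      have a4 := hρ₂ i
      have a5 := hxt i
      have a6 := hyt j
      have a7 := hyt j'
      simp only
      try omega
    rw [← hjj]
    omega
  · intro i i' j hii
    refine ⟨_, hlow i j, _, hu i' j, h₁.adj _ _ ?_ ?_ ?_ ?_ (Or.inr (Or.inl ⟨rfl, Or.inl ?_⟩))⟩
    all_goals
      have a1 := hpx i
      have a2 := hpy j
      have a3 := hpx i'
      have a4 := hκ₂ j
      have a5 := hxt i
      have a6 := hyt j
      have a7 := hxt i'
      simp only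
      try omega
    rw [← hii]
    omega
  · exact fun i i' j j' h => (hdis i j i' j' (fun e => h (Prod.mk.inj e).1)).mono (hX _ _) (hX _ _)
  · exact fun i i' j j' h => (hdis i j i' j' (fun e => h (Prod.mk.inj e).2)).mono (hY _ _) (hY _ _)
  · intro i i' j j'
    by_cases h : (i, j) = (i', j')
    · obtain ⟨rfl, rfl⟩ := Prod.mk.inj h
      exact dXY i j
    · exact (hdis i j i' j' h).mono (hX _ _) (hY _ _)

end Assembly

section Tile

variable {V : Type*} {U : SimpleGraph V} {L : ℕ} {d₁ d₂ : ℕ → ℕ → Bool} {ψ₁ ψ₂ : ℕ × ℕ → V}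

theorem eq_of_mul_add_near {G m n x : ℕ} {o : ℕ} (h₁ : o + m * G ≤ x) (h₂ : x < o + m * G + G)
    (h₃ : o + n * G ≤ x) (h₄ : x < o + n * G + G) : m = n := by
  rcases Nat.lt_trichotomy m n with h | h | h
  · nlinarith [Nat.mul_le_mul_right G (show m + 1 ≤ n from h)]
  · exact h
  · nlinarith [Nat.mul_le_mul_right G (show n + 1 ≤ m from h)]

theorem strip_eq {t g : ℕ} {i i' : Fin t} {a a' : Fin g}
    (h : i.val * g + a.val = i'.val * g + a'.val) : (i, a) = (i', a') := by
  have e := eq_of_mul_add_near (o := 0) (G := g) (m := i) (n := i') (x := i.val * g + a.val)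
    (by omega) (by omega) (by omega) (by omega)
  have hi : i = i' := Fin.ext e
  subst hi
  have : a = a' := Fin.ext (by omega)
  rw [this]

/-- A tile almost all of whose blocks contain a gadget yields a `K_t`-minor. -/
theorem hasMinor_of_tile (h₁ : GridEmb U L d₁ ψ₁) (h₂ : GridEmb U L d₂ ψ₂)
    {t g G A H β TX TY : ℕ} (hA : β + 1 ≤ A) (hH : A + β ≤ H) (hHt : A + t * t * β ≤ H)
    (hG : H + β + 1 < G) (hTX : TX + t * g * G ≤ L) (hTY : TY + t * g * G ≤ L)
    (hg : 2 * (t ^ 4 * β) ≤ g) (Bad : Finset ((Fin t × Fin g) × (Fin t × Fin g)))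
    (hBad : 2 * Bad.card < g ^ 2)
    (hgad : ∀ b, b ∉ Bad → ∃ P, IsGadget U d₁ ψ₁ ψ₂ (TX + (b.1.1.val * g + b.1.2.val) * G)
      (TY + (b.2.1.val * g + b.2.2.val) * G) A H β P) :
    U.HasMinor (⊤ : SimpleGraph (Fin t)) := by
  classical
  have hg0 : g ≠ 0 := by
    rintro rfl
    simp at hBad
  have : NeZero g := ⟨hg0⟩
  let o : ℕ → Fin t × Fin g → ℕ := fun T b => T + (b.1.val * g + b.2.val) * G
  have hstrip : ∀ (T : ℕ) (i : Fin t) (a : Fin g), T + i * (g * G) ≤ o T (i, a) ∧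
      o T (i, a) + G ≤ T + (i + 1) * (g * G) := by
    intro T i a
    simp only [o]
    constructor
    · nlinarith [Nat.zero_le (a.val * G)]
    · nlinarith [Nat.mul_le_mul_right G (show a.val + 1 ≤ g from a.2)]
  have hoL : ∀ (T : ℕ) (b : Fin t × Fin g), T + t * g * G ≤ L → o T b + G ≤ L := by
    rintro T ⟨i, a⟩ hT
    have h1 := (hstrip T i a).2
    have h2 : (i.val + 1) * (g * G) ≤ t * (g * G) := Nat.mul_le_mul_right _ i.2
    have h3 : t * g * G = t * (g * G) := Nat.mul_assoc _ _ _
    omega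
  have hosep : ∀ (T : ℕ) (b b' : Fin t × Fin g) (x : ℕ), o T b ≤ x → x < o T b + G →
      o T b' ≤ x → x < o T b' + G → b = b' := by
    rintro T ⟨i, a⟩ ⟨i', a'⟩ x h1 h2 h3 h4
    exact strip_eq (eq_of_mul_add_near h1 h2 h3 h4)
  have hgad' : ∀ b, ∃ P, b ∉ Bad → IsGadget U d₁ ψ₁ ψ₂ (o TX b.1) (o TY b.2) A H β P := by
    intro b
    by_cases hb : b ∈ Bad
    · exact ⟨∅, fun h => absurd hb h⟩
    · obtain ⟨P, hP⟩ := hgad b hb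
      exact ⟨P, fun _ => hP⟩
  choose P hP using hgad'
  let inP : (Fin t × Fin g) × (Fin t × Fin g) → ℕ × ℕ → Prop := fun b z =>
    o TX b.1 ≤ z.1 ∧ z.1 < o TX b.1 + G ∧ o TY b.2 ≤ z.2 ∧ z.2 < o TY b.2 + G
  let Hit : (Fin t × Fin g) × (Fin t × Fin g) → Finset ((Fin t × Fin g) × (Fin t × Fin g)) :=
    fun b => if b ∈ Bad then ∅ else
      Finset.univ.filter fun b' => ∃ z ∈ P b, ∃ z', inP b' z' ∧ ψ₂ z = ψ₁ z'
  have hHit : ∀ b, (Hit b).card ≤ β := by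
    intro b
    by_cases hb : b ∈ Bad
    · simp [Hit, hb]
    have hmem : ∀ b' ∈ Hit b, ∃ z ∈ P b, ∃ z', inP b' z' ∧ ψ₂ z = ψ₁ z' := by
      intro b' hb'
      simpa [Hit, hb] using hb'
    choose! z hz z' hz' he using hmem
    refine (Finset.card_le_card_of_injOn z hz ?_).trans (hP b hb).1
    intro x hx y hy e
    have hx' := hz' x hx
    have hy' := hz' y hy
    have l1 := hoL TX x.1 hTX
    have l2 := hoL TY x.2 hTY
    have l3 := hoL TX y.1 hTX
    have l4 := hoL TY y.2 hTY
    simp only [inP] at hx' hy'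
    have e' : z' x = z' y := h₁.inj _ _ (by omega) (by omega) (by omega) (by omega)
      ((he x hx).symm.trans ((congrArg ψ₂ e).trans (he y hy)))
    rw [e'] at hx'
    exact Prod.ext (hosep TX _ _ _ hx'.1 hx'.2.1 hy'.1 hy'.2.1)
      (hosep TY _ _ _ hx'.2.2.1 hx'.2.2.2 hy'.2.2.1 hy'.2.2.2)
  obtain ⟨s, u, hs, hsu⟩ := exists_selection Bad Hit (by simpa using hBad) hHit (by simpa using hg)
  refine hasMinor_of_gadgets h₁ h₂ hA hH hHt hG (fun i => TX + i * (g * G))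
    (fun i => TY + i * (g * G)) (fun i i' h => Nat.add_le_add_left (Nat.mul_le_mul_right _ h) _)
    (fun i i' h => Nat.add_le_add_left (Nat.mul_le_mul_right _ h) _)
    (by rwa [← Nat.mul_assoc]) (by rwa [← Nat.mul_assoc]) (fun i => o TX (i, s i))
    (fun j => o TY (j, u j)) (fun i => hstrip TX i (s i)) (fun j => hstrip TY j (u j))
    (fun i j => P ((i, s i), (j, u j))) (fun i j => hP _ (hs i j)) ?_
  intro i j i' j' hij z hz z' c1 c2 c3 c4 e
  refine hsu i j i' j' hij ?_
  simp only [Hit, hs i j, if_false, Finset.mem_filter, Finset.mem_univ, true_and]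
  exact ⟨z, hz, z', ⟨c1, c2, c3, c4⟩, e⟩

end Tile

section Closure

variable {V : Type*} {U : SimpleGraph V} {L : ℕ}

/-- A set of positions whose image under every embedded triangulated grid is connected. -/
def GridConn (U : SimpleGraph V) (L : ℕ) (Y : Set (ℕ × ℕ)) : Prop :=
  ∀ (d : ℕ → ℕ → Bool) (ψ : ℕ × ℕ → V), GridEmb U L d ψ → ConnOn U (ψ '' Y)

/-- If many embeddings agree on `t` neighbours of a connected set `Y` of positions, then many of
them agree on a position of `Y` as well, unless there is a `K_t`-minor. -/
theorem exists_popular_image {ι : Type*} {t : ℕ} (ht : 0 < t)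
    (hK : ¬ U.HasMinor (⊤ : SimpleGraph (Fin t))) {d : ι → ℕ → ℕ → Bool} {ψ : ι → ℕ × ℕ → V}
    (hψ : ∀ c, GridEmb U L (d c) (ψ c)) (F : Finset ι) (hF : F.Nonempty) (Y : Finset (ℕ × ℕ))
    (hYL : ∀ p ∈ Y, p.1 < L ∧ p.2 < L) (hY : GridConn U L Y) (n y : Fin t → ℕ × ℕ)
    (hn : Function.Injective n) (hnL : ∀ i, (n i).1 < L ∧ (n i).2 < L) (hnY : ∀ i, n i ∉ Y)
    (hy : ∀ i, y i ∈ Y) (hadj : ∀ i d, TAdj d (n i) (y i))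
    (hagree : ∀ c ∈ F, ∀ c' ∈ F, ∀ i, ψ c (n i) = ψ c' (n i)) :
    ∃ q ∈ Y, ∃ F' ⊆ F, (∀ c ∈ F', ∀ c' ∈ F', ψ c q = ψ c' q) ∧
      F.card ≤ t * Y.card ^ 2 * F'.card := by
  classical
  have hUadj : ∀ c i, U.Adj (ψ c (n i)) (ψ c (y i)) := fun c i =>
    (hψ c).adj _ _ (hnL i).1 (hnL i).2 (hYL _ (hy i)).1 (hYL _ (hy i)).2 (hadj i _)
  have hnot : ∀ c i, ψ c (n i) ∉ ψ c '' Y := by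
    rintro c i ⟨p, hp, e⟩
    have := (hψ c).inj _ _ (hYL p hp).1 (hYL p hp).2 (hnL i).1 (hnL i).2 e
    exact hnY i (this ▸ hp)
  let Dis : Finset ι → Prop := fun M =>
    ∀ c ∈ M, ∀ c' ∈ M, c ≠ c' → Disjoint (ψ c '' Y) (ψ c' '' Y)
  obtain ⟨M, hM, hmax⟩ := Finset.exists_max_image (F.powerset.filter Dis) Finset.card
    ⟨∅, by simp [Dis]⟩
  rw [Finset.mem_filter, Finset.mem_powerset] at hM
  obtain ⟨hMF, hMd⟩ := hM
  have hMt : M.card ≤ t := by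
    by_contra! hlt
    apply hK
    obtain ⟨e⟩ : Nonempty (Fin t ↪ M) :=
      Function.Embedding.nonempty_of_card_le (by simpa using hlt.le)
    have heF : ∀ i, (e i : ι) ∈ F := fun i => hMF (e i).2
    refine ⟨fun i => insert (ψ (e i) (n i)) (ψ (e i) '' Y), fun i => ?_, fun i j hij => ?_,
      fun i j hij => ?_⟩
    · exact (connOn_singleton (ψ (e i) (n i))).union_of_linked (hY _ _ (hψ (e i)))
        ⟨_, rfl, _, ⟨y i, hy i, rfl⟩, hUadj _ i⟩
    · have hne : (e i : ι) ≠ e j := fun h => hij (e.injective (Subtype.ext h))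
      refine Set.disjoint_left.2 ?_
      rintro v (rfl | hv) (h | hv')
      · rw [hagree _ (heF i) _ (heF j)] at h
        exact hij (hn ((hψ (e j)).inj _ _ (hnL i).1 (hnL i).2 (hnL j).1 (hnL j).2 h))
      · rw [hagree _ (heF i) _ (heF j)] at hv'
        exact hnot _ _ hv'
      · rw [h, hagree _ (heF j) _ (heF i)] at hv
        exact hnot _ _ hv
      · exact Set.disjoint_left.1 (hMd _ (e i).2 _ (e j).2 hne) hv hv'
    · refine ⟨ψ (e i) (y j), Or.inr ⟨_, hy j, rfl⟩, ψ (e j) (n j), Or.inl rfl, ?_⟩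
      rw [hagree _ (heF j) _ (heF i)]
      exact (hUadj _ j).symm
  have hcov : ∀ c ∈ F, ∃ x ∈ M ×ˢ (Y ×ˢ Y), ψ c x.2.2 = ψ x.1 x.2.1 := by
    intro c hc
    by_cases hcM : c ∈ M
    · exact ⟨(c, y ⟨0, ht⟩, y ⟨0, ht⟩), by simp [hcM, hy], rfl⟩
    by_contra! hcon
    have hins := hmax (insert c M) (by
      rw [Finset.mem_filter, Finset.mem_powerset]
      refine ⟨Finset.insert_subset hc hMF, ?_⟩
      have hd : ∀ m ∈ M, Disjoint (ψ c '' Y) (ψ m '' Y) := by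
        intro m hm
        rw [Set.disjoint_left]
        rintro _ ⟨q, hq, rfl⟩ ⟨p, hp, e⟩
        exact hcon (m, p, q) (by simpa using ⟨hm, hp, hq⟩) e.symm
      intro c₁ h₁ c₂ h₂ hne
      rw [Finset.mem_insert] at h₁ h₂
      rcases h₁ with rfl | h₁ <;> rcases h₂ with rfl | h₂
      · exact absurd rfl hne
      · exact hd _ h₂
      · exact (hd _ h₁).symm
      · exact hMd _ h₁ _ h₂ hne)
    rw [Finset.card_insert_of_notMem hcM] at hins
    omega
  let B : ι × (ℕ × ℕ) × (ℕ × ℕ) → Finset ι := fun x => F.filter fun c => ψ c x.2.2 = ψ x.1 x.2.1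
  have hcover : F ⊆ (M ×ˢ (Y ×ˢ Y)).biUnion B := by
    intro c hc
    obtain ⟨x, hx, e⟩ := hcov c hc
    exact Finset.mem_biUnion.2 ⟨x, hx, Finset.mem_filter.2 ⟨hc, e⟩⟩
  obtain ⟨c₀, hc₀⟩ := hF
  obtain ⟨x₀, hx₀, -⟩ := hcov c₀ hc₀
  obtain ⟨x, hx, hxmax⟩ := Finset.exists_max_image (M ×ˢ (Y ×ˢ Y)) (fun x => (B x).card) ⟨x₀, hx₀⟩
  rw [Finset.mem_product, Finset.mem_product] at hx
  refine ⟨x.2.2, hx.2.2, B x, Finset.filter_subset _ _, ?_, ?_⟩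
  · intro c hc c' hc'
    rw [(Finset.mem_filter.1 hc).2, (Finset.mem_filter.1 hc').2]
  · calc F.card ≤ ((M ×ˢ (Y ×ˢ Y)).biUnion B).card := Finset.card_le_card hcover
      _ ≤ ∑ x ∈ M ×ˢ (Y ×ˢ Y), (B x).card := Finset.card_biUnion_le
      _ ≤ (M ×ˢ (Y ×ˢ Y)).card * (B x).card := Finset.sum_le_card_nsmul _ _ _ hxmax
      _ = M.card * Y.card ^ 2 * (B x).card := by rw [Finset.card_product, Finset.card_product, sq]
      _ ≤ t * Y.card ^ 2 * (B x).card := by gcongr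

/-- No connected set of at most `m` positions of `W` outside `S` has `t` neighbours in `S`. -/
def IsClosedIn (U : SimpleGraph V) (L t m : ℕ) (W S : Finset (ℕ × ℕ)) : Prop :=
  ∀ Y ⊆ W, Disjoint Y S → Y.card ≤ m → GridConn U L Y → ∀ n y : Fin t → ℕ × ℕ,
    Function.Injective n → (∀ i, n i ∈ S) → (∀ i, y i ∈ Y) → (∀ i d, TAdj d (n i) (y i)) → False

/-- A family of embeddings has a large subfamily agreeing on a set of positions that contains
`B` and is closed in `W`. -/
theorem exists_closed_agreement {ι : Type*} [Fintype ι] [Nonempty ι] [Fintype V] {t m : ℕ}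
    (ht : 0 < t) (hm : 0 < m) (hK : ¬ U.HasMinor (⊤ : SimpleGraph (Fin t)))
    {d : ι → ℕ → ℕ → Bool} {ψ : ι → ℕ × ℕ → V} (hψ : ∀ c, GridEmb U L (d c) (ψ c))
    (B W : Finset (ℕ × ℕ)) (hBW : B ⊆ W) (hWL : ∀ p ∈ W, p.1 < L ∧ p.2 < L) :
    ∃ S, B ⊆ S ∧ S ⊆ W ∧ IsClosedIn U L t m W S ∧ ∃ F : Finset ι,
      (∀ c ∈ F, ∀ c' ∈ F, ∀ p ∈ S, ψ c p = ψ c' p) ∧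
      Fintype.card ι ≤ Fintype.card V ^ B.card * (t * m ^ 2) ^ W.card * F.card := by
  classical
  have htm : 0 < t * m ^ 2 := by positivity
  let Good : Finset (ℕ × ℕ) → Prop := fun S => B ⊆ S ∧ ∃ F : Finset ι, F.Nonempty ∧
    (∀ c ∈ F, ∀ c' ∈ F, ∀ p ∈ S, ψ c p = ψ c' p) ∧
      Fintype.card ι ≤ Fintype.card V ^ B.card * (t * m ^ 2) ^ S.card * F.card
  have hB : Good B := by
    refine ⟨subset_rfl, ?_⟩
    obtain ⟨f, -, hf⟩ := Finset.exists_max_image (Finset.univ : Finset (B → V))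
      (fun f => (Finset.univ.filter fun c : ι => (fun p : B => ψ c p) = f).card)
      ⟨fun p => ψ (Classical.arbitrary ι) p, Finset.mem_univ _⟩
    have hcard : Fintype.card ι ≤ Fintype.card V ^ B.card *
        (Finset.univ.filter fun c : ι => (fun p : B => ψ c p) = f).card := by
      calc Fintype.card ι = ∑ f : B → V,
            (Finset.univ.filter fun c : ι => (fun p : B => ψ c p) = f).card :=
            Finset.card_eq_sum_card_fiberwise (f := fun c => fun p : B => ψ c p)
              (s := (Finset.univ : Finset ι)) (t := Finset.univ) (fun _ _ => Finset.mem_univ _)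
        _ ≤ _ := Finset.sum_le_card_nsmul _ _ _ hf
        _ = _ := by simp
    refine ⟨_, ?_, ?_, hcard.trans (Nat.mul_le_mul_right _
      (Nat.le_mul_of_pos_right _ (by positivity)))⟩
    · rw [← Finset.card_pos]
      by_contra h0
      rw [Nat.eq_zero_of_not_pos h0, Nat.mul_zero] at hcard
      exact hcard.not_gt Fintype.card_pos
    · intro c hc c' hc' p hp
      have h1 := congrFun ((Finset.mem_filter.1 hc).2.trans (Finset.mem_filter.1 hc').2.symm)
        ⟨p, hp⟩
      exact h1
  obtain ⟨S, hS, hmax⟩ := Finset.exists_max_image (W.powerset.filter Good) Finset.card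
    ⟨B, by simpa using ⟨hBW, hB⟩⟩
  rw [Finset.mem_filter, Finset.mem_powerset] at hS
  obtain ⟨hSW, hBS, F, hF, hFS, hFc⟩ := hS
  refine ⟨S, hBS, hSW, ?_, F, hFS, hFc.trans ?_⟩
  · intro Y hYW hYS hYm hYc n y hn hnS hy hadj
    obtain ⟨q, hq, F', hF', hagree, hcard⟩ := exists_popular_image ht hK hψ F hF Y
      (fun p hp => hWL p (hYW hp)) hYc n y hn (fun i => hWL _ (hSW (hnS i)))
      (fun i h => Finset.disjoint_left.1 hYS h (hnS i)) hy hadj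
      (fun c hc c' hc' i => hFS c hc c' hc' _ (hnS i))
    have hqS : q ∉ S := Finset.disjoint_left.1 hYS hq
    have hins := hmax (insert q S) (by
      rw [Finset.mem_filter, Finset.mem_powerset]
      refine ⟨Finset.insert_subset (hYW hq) hSW, hBS.trans (Finset.subset_insert _ _), F', ?_, ?_,
        ?_⟩
      · rw [← Finset.card_pos]
        by_contra h0
        rw [Nat.eq_zero_of_not_pos h0, Nat.mul_zero] at hcard
        have := hF.card_pos
        omega
      · intro c hc c' hc' p hp
        rw [Finset.mem_insert] at hp
        rcases hp with rfl | hp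
        · exact hagree c hc c' hc'
        · exact hFS c (hF' hc) c' (hF' hc') p hp
      · rw [Finset.card_insert_of_notMem hqS, pow_succ]
        calc Fintype.card ι ≤ Fintype.card V ^ B.card * (t * m ^ 2) ^ S.card * F.card := hFc
          _ ≤ Fintype.card V ^ B.card * (t * m ^ 2) ^ S.card * (t * Y.card ^ 2 * F'.card) := by
            gcongr
          _ ≤ Fintype.card V ^ B.card * (t * m ^ 2) ^ S.card * (t * m ^ 2 * F'.card) := by gcongr
          _ = _ := by ring)
    rw [Finset.card_insert_of_notMem hqS] at hins
    omega
  · gcongr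

end Closure

section Propagation

variable {V : Type*} {U : SimpleGraph V} {L t : ℕ} {W S : Finset (ℕ × ℕ)}

/-- A closed set contains no comb: `t` disjoint paths that start on a line avoiding
the set and lead into it. -/
theorem IsClosedIn.no_comb {m l : ℕ} (hS : IsClosedIn U L t m W S)
    (hWL : ∀ p ∈ W, p.1 < L ∧ p.2 < L) (ht : 0 < t) (hm : t * l ≤ m) (q : ℕ → ℕ → ℕ × ℕ)
    (len : ℕ → ℕ) (hlen : ∀ k < t, len k ≤ l)
    (hend : ∀ k < t, q k (len k) ∈ S) (hstart : ∀ k < t, q k 0 ∉ S)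
    (hW : ∀ k < t, ∀ a ≤ len k, q k a ∈ W)
    (hline : ∀ k, k + 1 < t → ∀ d, TAdj d (q k 0) (q (k + 1) 0))
    (hray : ∀ k < t, ∀ a < len k, ∀ d, TAdj d (q k a) (q k (a + 1)))
    (hdisj : ∀ k < t, ∀ k' < t, ∀ a ≤ len k, ∀ a' ≤ len k', q k a = q k' a' → k = k') : False := by
  classical
  have hex : ∀ k, k < t → ∃ a, q k a ∈ S := fun k hk => ⟨_, hend k hk⟩
  let M : ℕ → ℕ := fun k => if h : k < t then Nat.find (hex k h) else 0
  have hMS : ∀ k < t, q k (M k) ∈ S := by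
    intro k hk
    simp only [M, dif_pos hk]
    exact Nat.find_spec (hex k hk)
  have hMlt : ∀ k < t, ∀ a < M k, q k a ∉ S := by
    intro k hk a ha
    simp only [M, dif_pos hk] at ha
    exact Nat.find_min (hex k hk) ha
  have hMlen : ∀ k < t, M k ≤ len k := by
    intro k hk
    by_contra! h
    exact hMlt k hk _ h (hend k hk)
  have hMpos : ∀ k < t, 0 < M k := by
    intro k hk
    rw [Nat.pos_iff_ne_zero]
    intro h
    exact hstart k hk (h ▸ hMS k hk)
  let Y : Finset (ℕ × ℕ) := (Finset.range t).biUnion fun k => (Finset.range (M k)).image (q k)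
  have hY : ∀ p, p ∈ Y ↔ ∃ k < t, ∃ a < M k, q k a = p := by
    intro p
    simp [Y]
  refine hS Y ?_ ?_ ?_ ?_ (fun k => q k (M k)) (fun k => q k (M k - 1)) ?_ (fun k => hMS k k.2)
    (fun k => (hY _).2 ⟨k, k.2, _, Nat.sub_lt (hMpos k k.2) one_pos, rfl⟩) ?_
  · intro p hp
    obtain ⟨k, hk, a, ha, rfl⟩ := (hY p).1 hp
    exact hW k hk a (ha.le.trans (hMlen k hk))
  · rw [Finset.disjoint_left]
    intro p hp
    obtain ⟨k, hk, a, ha, rfl⟩ := (hY p).1 hp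
    exact hMlt k hk a ha
  · refine (Finset.card_biUnion_le_card_mul _ _ l fun k hk => ?_).trans (by simpa using hm)
    refine Finset.card_image_le.trans ?_
    rw [Finset.card_range]
    exact (hMlen k (Finset.mem_range.1 hk)).trans (hlen k (Finset.mem_range.1 hk))
  · intro d ψ hψ
    have hUadj : ∀ p p', p ∈ W → p' ∈ W → TAdj d p p' → U.Adj (ψ p) (ψ p') := fun p p' h h' =>
      hψ.adj p p' (hWL p h).1 (hWL p h).2 (hWL p' h').1 (hWL p' h').2
    convert connOn_chain (U := U) (a := 0) (b := t - 1)
      (X := fun k => {v | ∃ a, 0 ≤ a ∧ a ≤ M k - 1 ∧ v ∈ ({ψ (q k a)} : Set V)}) (Nat.zero_le _)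
      (fun k _ hk => connOn_chain (Nat.zero_le _) (fun _ _ _ => connOn_singleton _)
        (fun a _ ha => ?_)) (fun k _ hk => ?_) using 1
    · ext v
      constructor
      · rintro ⟨p, hp, rfl⟩
        obtain ⟨k, hk, a, ha, rfl⟩ := (hY p).1 hp
        exact ⟨k, Nat.zero_le _, by omega, a, Nat.zero_le _, by omega, rfl⟩
      · rintro ⟨k, -, hk, a, -, ha, rfl⟩
        have := hMpos k (by omega)
        exact ⟨_, (hY _).2 ⟨k, by omega, a, by omega, rfl⟩, rfl⟩
    · have hk' : k < t := by omega
      have := hMlen k hk'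
      exact ⟨_, rfl, _, rfl, hUadj _ _ (hW k hk' a (by omega)) (hW k hk' _ (by omega))
        (hray k hk' a (by omega) d)⟩
    · have hk' : k + 1 < t := by omega
      exact ⟨_, ⟨0, le_rfl, Nat.zero_le _, rfl⟩, _, ⟨0, le_rfl, Nat.zero_le _, rfl⟩,
        hUadj _ _ (hW k (by omega) 0 (Nat.zero_le _)) (hW _ hk' 0 (Nat.zero_le _)) (hline k hk' d)⟩
  · intro k k' h
    exact Fin.ext (hdisj k k.2 k' k'.2 _ (hMlen k k.2) _ (hMlen k' k'.2) h)
  · intro k d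
    have h1 := hMpos k k.2
    have h2 := hMlen k k.2
    have h3 := hray k k.2 (M k - 1) (by omega) d
    rw [Nat.sub_add_cancel h1] at h3
    exact h3.symm

/-- In a `2t × t` chart, a closed set that meets all lines `b = const` in the first half meets
all lines in the second half. -/
theorem IsClosedIn.meets_chart {m : ℕ} (hS : IsClosedIn U L t m W S)
    (hWL : ∀ p ∈ W, p.1 < L ∧ p.2 < L) (hm : 2 * t ^ 2 ≤ m) (φ : ℕ → ℕ → ℕ × ℕ)
    (hφW : ∀ a < 2 * t, ∀ b < t, φ a b ∈ W)
    (hφ : ∀ a < 2 * t, ∀ b < t, ∀ a' < 2 * t, ∀ b' < t, φ a b = φ a' b' → a = a' ∧ b = b')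
    (hφa : ∀ a b d, a + 1 < 2 * t → b < t → TAdj d (φ a b) (φ (a + 1) b))
    (hφb : ∀ a b d, a < 2 * t → b + 1 < t → TAdj d (φ a b) (φ a (b + 1)))
    (hmeet : ∀ b < t, ∃ a < t, φ a b ∈ S) :
    (∀ b < t, ∃ a < t, φ (t + a) b ∈ S) ∧ ∀ a < t, ∃ b < t, φ (t + a) b ∈ S := by
  have hm' : t * (2 * t) ≤ m := by
    calc t * (2 * t) = 2 * t ^ 2 := by ring
      _ ≤ m := hm
  have key : ∀ a < t, ∃ b < t, φ (t + a) b ∈ S := by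
    intro a ha
    by_contra! hcon
    choose! s hs hsS using hmeet
    refine hS.no_comb hWL (by omega) hm' (fun b n => φ (t + a - n) b) (fun b => t + a - s b)
      (fun b _ => by omega) (fun b hb => ?_) (fun b hb => hcon b hb)
      (fun b hb n _ => hφW _ (by omega) b hb) (fun b hb d => hφb _ _ d (by omega) hb)
      (fun b hb n hn d => ?_) (fun b hb b' hb' n _ n' _ e => ?_)
    · have := hs b hb
      rw [Nat.sub_sub_self (by omega)]
      exact hsS b hb
    · have h1 := hφa (t + a - (n + 1)) b d (by omega) hb
      rw [show t + a - (n + 1) + 1 = t + a - n by omega] at h1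
      exact h1.symm
    · exact (hφ _ (by omega) _ hb _ (by omega) _ hb' e).2
  refine ⟨?_, key⟩
  intro b hb
  by_contra! hcon
  choose! s hs hsS using key
  let c : ℕ → ℕ → ℕ := fun k n => if b ≤ s k then b + n else b - n
  have hc : ∀ k < t, ∀ n ≤ (s k - b) + (b - s k), c k n < t := by
    intro k hk n hn
    have := hs k hk
    simp only [c]
    split_ifs <;> omega
  refine hS.no_comb hWL (by omega) hm' (fun k n => φ (t + k) (c k n))
    (fun k => (s k - b) + (b - s k)) (fun k hk => ?_) (fun k hk => ?_) (fun k hk => ?_)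
    (fun k hk n hn => hφW _ (by omega) _ (hc k hk n hn)) (fun k hk d => ?_)
    (fun k hk n hn d => ?_) (fun k hk k' hk' n hn n' hn' e => ?_)
  · have := hs k hk
    omega
  · have : c k ((s k - b) + (b - s k)) = s k := by
      simp only [c]
      split_ifs <;> omega
    simp only [this]
    exact hsS k hk
  · simpa [c] using hcon k hk
  · simpa [c, add_assoc] using hφa (t + k) b d (by omega) hb
  · have := hs k hk
    simp only [c]
    split_ifs
    · exact hφb _ _ d (by omega) (by omega)
    · have h1 := hφb (t + k) (b - (n + 1)) d (by omega) (by omega)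
      rw [show b - (n + 1) + 1 = b - n by omega] at h1
      exact h1.symm
  · have := (hφ _ (by omega) _ (hc k hk n hn) _ (by omega) _ (hc k' hk' n' hn') e).1
    omega

/-- The set `S` meets every row and every column of the `t × t` box with index `(X, Y)`. -/
def MeetsBox (t : ℕ) (S : Finset (ℕ × ℕ)) (X Y : ℕ) : Prop :=
  (∀ b < t, ∃ a < t, (X * t + a, Y * t + b) ∈ S) ∧ ∀ a < t, ∃ b < t, (X * t + a, Y * t + b) ∈ S

theorem all_of_step {P : ℕ → Prop} {M n₀ : ℕ} (h₀ : P n₀) (hn₀ : n₀ < M)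
    (hs : ∀ n, n + 1 < M → (P n ↔ P (n + 1))) : ∀ n < M, P n := by
  have : ∀ n < M, P n ↔ P 0 := by
    intro n hn
    induction n with
    | zero => rfl
    | succ n ih => exact (hs n hn).symm.trans (ih (by omega))
  exact fun n hn => (this n hn).2 ((this n₀ hn₀).1 h₀)

/-- The positions in the boxes `(X, Y)` for which `X` or `Y` satisfies `R`. -/
def wallSet (L t : ℕ) (R : ℕ → Prop) [DecidablePred R] : Finset (ℕ × ℕ) :=
  (Finset.range L ×ˢ Finset.range L).filter fun p => R (p.1 / t) ∨ R (p.2 / t)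

/-- A closed set that contains a crossing box of the walls meets all boxes of the walls. -/
theorem IsClosedIn.meetsBox {m M r : ℕ} {R : ℕ → Prop} [DecidablePred R]
    (hS : IsClosedIn U (M * t) t m (wallSet (M * t) t R) S) (hm : 2 * t ^ 2 ≤ m) (hr : r < M)
    (hR : R r) (hroot : ∀ a < t, ∀ b < t, (r * t + a, r * t + b) ∈ S) {X Y : ℕ} (hX : X < M)
    (hY : Y < M) (hXY : R X ∨ R Y) : MeetsBox t S X Y := by
  have hWL : ∀ p ∈ wallSet (M * t) t R, p.1 < M * t ∧ p.2 < M * t := by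
    intro p hp
    simpa using (Finset.mem_filter.1 hp).1
  have hmem : ∀ X < M, ∀ Y < M, R X ∨ R Y → ∀ a < t, ∀ b < t,
      (X * t + a, Y * t + b) ∈ wallSet (M * t) t R := by
    intro X hX Y hY h a ha b hb
    have h1 : ∀ Z < M, ∀ c < t, Z * t + c < M * t ∧ (Z * t + c) / t = Z := by
      intro Z hZ c hc
      refine ⟨by nlinarith [Nat.mul_le_mul_right t (show Z + 1 ≤ M from hZ)], ?_⟩
      rw [mul_comm, Nat.mul_add_div (by omega), Nat.div_eq_of_lt hc, add_zero]
    simp only [wallSet, Finset.mem_filter, Finset.mem_product, Finset.mem_range]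
    rw [(h1 X hX a ha).2, (h1 Y hY b hb).2]
    exact ⟨⟨(h1 X hX a ha).1, (h1 Y hY b hb).1⟩, h⟩
  have hmem2 : ∀ X, X + 1 < M → ∀ Y < M, R Y → ∀ a < 2 * t, ∀ b < t,
      (X * t + a, Y * t + b) ∈ wallSet (M * t) t R ∧
      (Y * t + b, X * t + a) ∈ wallSet (M * t) t R := by
    intro X hX Y hY h a ha b hb
    rcases Nat.lt_or_ge a t with h1 | h1
    · exact ⟨hmem X (by omega) Y hY (Or.inr h) a h1 b hb,
        hmem Y hY X (by omega) (Or.inl h) b hb a h1⟩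
    · have h2 : X * t + a = (X + 1) * t + (a - t) := by
        rw [add_mul]
        omega
      rw [h2]
      exact ⟨hmem _ hX Y hY (Or.inr h) _ (by omega) b hb,
        hmem Y hY _ hX (Or.inl h) b hb _ (by omega)⟩
  have hstepX : ∀ Y < M, R Y → ∀ X, X + 1 < M → (MeetsBox t S X Y ↔ MeetsBox t S (X + 1) Y) := by
    intro Y hY h X hX
    have e : (X + 1) * t = X * t + t := by ring
    unfold MeetsBox
    rw [e]
    constructor
    · rintro ⟨h1, -⟩
      have := hS.meets_chart hWL hm (fun a b => (X * t + a, Y * t + b))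
        (fun a ha b hb => (hmem2 X hX Y hY h a ha b hb).1)
        (fun a _ b _ a' _ b' _ e => by simpa using e)
        (fun a b d _ _ => Or.inr (Or.inl ⟨rfl, Or.inl rfl⟩))
        (fun a b d _ _ => Or.inl ⟨rfl, Or.inl rfl⟩) h1
      simpa only [add_assoc] using this
    · rintro ⟨h1, -⟩
      have := hS.meets_chart hWL hm (fun a b => (X * t + (2 * t - 1 - a), Y * t + b))
        (fun a ha b hb => (hmem2 X hX Y hY h _ (by omega) b hb).1)
        (fun a _ b _ a' _ b' _ e => by
          simp only [Prod.mk.injEq] at e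
          omega)
        (fun a b d _ _ => Or.inr (Or.inl ⟨rfl, Or.inr (by simp only; omega)⟩))
        (fun a b d _ _ => Or.inl ⟨rfl, Or.inl rfl⟩) (fun b hb => by
          obtain ⟨a, ha, hab⟩ := h1 b hb
          refine ⟨t - 1 - a, by omega, ?_⟩
          rwa [show X * t + (2 * t - 1 - (t - 1 - a)) = X * t + t + a by omega])
      refine ⟨fun b hb => ?_, fun a ha => ?_⟩
      · obtain ⟨a, ha, hab⟩ := this.1 b hb
        refine ⟨t - 1 - a, by omega, ?_⟩
        rwa [show X * t + (t - 1 - a) = X * t + (2 * t - 1 - (t + a)) by omega]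
      · obtain ⟨b, hb, hab⟩ := this.2 (t - 1 - a) (by omega)
        refine ⟨b, hb, ?_⟩
        rwa [show X * t + a = X * t + (2 * t - 1 - (t + (t - 1 - a))) by omega]
  have hstepY : ∀ X < M, R X → ∀ Y, Y + 1 < M → (MeetsBox t S X Y ↔ MeetsBox t S X (Y + 1)) := by
    intro X hX h Y hY
    have e : (Y + 1) * t = Y * t + t := by ring
    unfold MeetsBox
    rw [e]
    constructor
    · rintro ⟨-, h1⟩
      have := hS.meets_chart hWL hm (fun a b => (X * t + b, Y * t + a))
        (fun a ha b hb => (hmem2 Y hY X hX h a ha b hb).2)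
        (fun a _ b _ a' _ b' _ e => by simpa [and_comm] using e)
        (fun a b d _ _ => Or.inl ⟨rfl, Or.inl rfl⟩)
        (fun a b d _ _ => Or.inr (Or.inl ⟨rfl, Or.inl rfl⟩)) h1
      simpa only [add_assoc] using this.symm
    · rintro ⟨-, h1⟩
      have := hS.meets_chart hWL hm (fun a b => (X * t + b, Y * t + (2 * t - 1 - a)))
        (fun a ha b hb => (hmem2 Y hY X hX h _ (by omega) b hb).2)
        (fun a _ b _ a' _ b' _ e => by
          simp only [Prod.mk.injEq] at e
          omega)
        (fun a b d _ _ => Or.inl ⟨rfl, Or.inr (by simp only; omega)⟩)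
        (fun a b d _ _ => Or.inr (Or.inl ⟨rfl, Or.inl rfl⟩)) (fun b hb => by
          obtain ⟨a, ha, hab⟩ := h1 b hb
          refine ⟨t - 1 - a, by omega, ?_⟩
          rwa [show Y * t + (2 * t - 1 - (t - 1 - a)) = Y * t + t + a by omega])
      refine ⟨fun b hb => ?_, fun a ha => ?_⟩
      · obtain ⟨a, ha, hab⟩ := this.2 (t - 1 - b) (by omega)
        refine ⟨a, ha, ?_⟩
        rwa [show Y * t + b = Y * t + (2 * t - 1 - (t + (t - 1 - b))) by omega]
      · obtain ⟨b, hb, hab⟩ := this.1 a ha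
        refine ⟨t - 1 - b, by omega, ?_⟩
        rwa [show Y * t + (t - 1 - b) = Y * t + (2 * t - 1 - (t + b)) by omega]
  have h₀ : MeetsBox t S r r :=
    ⟨fun b hb => ⟨b, hb, hroot b hb b hb⟩, fun a ha => ⟨a, ha, hroot a ha a ha⟩⟩
  rcases hXY with h | h
  · have h1 : MeetsBox t S X r := all_of_step (P := fun X => MeetsBox t S X r) h₀ hr
      (hstepX r hr hR) X hX
    exact all_of_step (P := MeetsBox t S X) h1 hr (hstepY X hX h) Y hY
  · have h1 : MeetsBox t S r Y := all_of_step (P := MeetsBox t S r) h₀ hr (hstepY r hr hR) Y hY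
    exact all_of_step (P := fun X => MeetsBox t S X Y) h1 hr (hstepX Y hY h) X hX

end Propagation

section Core

variable {V : Type*} {U : SimpleGraph V} {L : ℕ} {d₁ d₂ : ℕ → ℕ → Bool} {ψ₁ ψ₂ : ℕ × ℕ → V}

/-- The residues modulo `G` of the indices of the walls around the core of a block. -/
def IsWall (b G n : ℕ) : Prop := n % G = b + 1 ∨ n % G = 2 * b

instance (b G : ℕ) : DecidablePred (IsWall b G) := fun n =>
  inferInstanceAs (Decidable (n % G = b + 1 ∨ n % G = 2 * b))

/-- Two embeddings that agree on a set meeting the walls have equal diagonals in the core of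
every block without a gadget. -/
theorem diagonals_eq_of_meetsBox {t b G M n₁ n₂ : ℕ} {S : Finset (ℕ × ℕ)} (ht : 2 ≤ t)
    (hb : 2 ≤ b) (hG : t ^ 2 * b + 2 * b + 2 ≤ G) (h₁ : GridEmb U (M * t) d₁ ψ₁)
    (h₂ : GridEmb U (M * t) d₂ ψ₂) (hagree : ∀ p ∈ S, ψ₁ p = ψ₂ p)
    (hmeet : ∀ X < M, ∀ Y < M, IsWall b G X ∨ IsWall b G Y → MeetsBox t S X Y)
    (hn₁ : (n₁ + 1) * G ≤ M) (hn₂ : (n₂ + 1) * G ≤ M)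
    (hno : ∀ P, ¬ IsGadget U d₁ ψ₁ ψ₂ (n₁ * (G * t)) (n₂ * (G * t)) (t * (b + 1))
      (t * (b + 1) + t * t * (t * b)) (t * b) P) {x y : ℕ}
    (hx : n₁ * (G * t) + t * (b + 2) ≤ x ∧ x + 1 < n₁ * (G * t) + t * (b + 2) + t * (b - 2))
    (hy : n₂ * (G * t) + t * (b + 2) ≤ y ∧ y + 1 < n₂ * (G * t) + t * (b + 2) + t * (b - 2)) :
    d₁ x y = d₂ x y := by
  have hGt : t * t * (t * b) + 2 * (t * b) + 2 * t ≤ G * t := by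
    nlinarith [Nat.mul_le_mul_right t hG]
  have hbb : t * (b - 2) + 2 * t = t * b := by
    obtain ⟨b, rfl⟩ := Nat.exists_eq_add_of_le' hb
    rw [Nat.add_sub_cancel]
    ring
  have hblock : ∀ n, (n + 1) * G ≤ M → n * (G * t) + G * t ≤ M * t := by
    intro n hn
    nlinarith [Nat.mul_le_mul_right t hn]
  have e1 : t * (b + 1) = t * b + t := by ring
  have e2 : t * (b + 2) = t * b + 2 * t := by ring
  have hwall : ∀ n, (n + 1) * G ≤ M → n * G + (b + 1) < M ∧ n * G + 2 * b < M ∧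
      IsWall b G (n * G + (b + 1)) ∧ IsWall b G (n * G + 2 * b) := by
    intro n hn
    have h1 : n * G + G ≤ M := by rwa [add_mul, one_mul] at hn
    have h3 : b + 1 < G ∧ 2 * b < G := by
      have : 0 ≤ t ^ 2 * b := Nat.zero_le _
      omega
    refine ⟨by omega, by omega, Or.inl ?_, Or.inr ?_⟩
    · rw [mul_comm, Nat.mul_add_mod, Nat.mod_eq_of_lt h3.1]
    · rw [mul_comm, Nat.mul_add_mod, Nat.mod_eq_of_lt h3.2]
  have hwt : ∀ n, (n * G + (b + 1)) * t = n * (G * t) + t * b + t ∧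
      (n * G + 2 * b) * t = n * (G * t) + 2 * (t * b) := by
    intro n
    constructor <;> ring
  have hdiv : ∀ i, i / t * t + i % t = i ∧ i % t < t := by
    intro i
    exact ⟨Nat.div_add_mod' i t, Nat.mod_lt _ (by omega)⟩
  have hlt : ∀ i, i < M * t → i / t < M := fun i hi => (Nat.div_lt_iff_lt_mul (by omega)).2 hi
  have b₁ := hblock n₁ hn₁
  have b₂ := hblock n₂ hn₂
  rw [e2] at hx hy
  refine diagonals_eq_of_no_gadget h₁ h₂ (A := t * (b + 1)) (β := t * b)
    (H := t * (b + 1) + t * t * (t * b)) ?_ ?_ ?_ hno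
    (cx := n₁ * (G * t) + (t * b + 2 * t)) (cy := n₂ * (G * t) + (t * b + 2 * t))
    (w := t * (b - 2)) ?_ ?_ ?_ ?_ hx hy
  · have : t * b ≤ t * t * (t * b) := Nat.le_mul_of_pos_left _ (by positivity)
    omega
  · omega
  · omega
  · omega
  · omega
  · intro i j hi hi' hj hj'
    obtain ⟨w1, w2, w3, w4⟩ := hwall n₂ hn₂
    obtain ⟨t1, t2⟩ := hwt n₂
    obtain ⟨v1, v2⟩ := hdiv i
    obtain ⟨c, hc, hcS⟩ := (hmeet (i / t) (hlt i (by omega)) _ w1 (Or.inr w3)).2 (i % t) v2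
    obtain ⟨c', hc', hcS'⟩ := (hmeet (i / t) (hlt i (by omega)) _ w2 (Or.inr w4)).2 (i % t) v2
    rw [v1] at hcS hcS'
    exact ⟨_, _, by omega, by omega, by omega, by omega, hagree _ hcS, hagree _ hcS'⟩
  · intro i j hi hi' hj hj'
    obtain ⟨w1, w2, w3, w4⟩ := hwall n₁ hn₁
    obtain ⟨t1, t2⟩ := hwt n₁
    obtain ⟨v1, v2⟩ := hdiv j
    obtain ⟨c, hc, hcS⟩ := (hmeet _ w1 (j / t) (hlt j (by omega)) (Or.inl w3)).1 (j % t) v2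
    obtain ⟨c', hc', hcS'⟩ := (hmeet _ w2 (j / t) (hlt j (by omega)) (Or.inl w4)).1 (j % t) v2
    rw [v1] at hcS hcS'
    exact ⟨_, _, by omega, by omega, by omega, by omega, hagree _ hcS, hagree _ hcS'⟩

end Core

section Code

/-- Reed-Solomon codes: two distinct codewords agree in fewer than `k` positions. -/
theorem exists_code (P B : Type*) [Fintype P] [Nonempty P] [Fintype B] (k : ℕ)
    (hB : Fintype.card B ≤ 2 ^ Fintype.card P) :
    ∃ code : (Fin k → P → Bool) → B → P → Bool, ∀ c c', c ≠ c' → ∀ Z : Finset B,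
      (∀ x ∈ Z, code c x = code c' x) → Z.card < k := by
  classical
  have : Fact (Nat.Prime 2) := ⟨Nat.prime_two⟩
  let F := GaloisField 2 (Fintype.card P)
  have hF : Nat.card F = 2 ^ Fintype.card P := GaloisField.card 2 _ Fintype.card_ne_zero
  let _ : Fintype F := Fintype.ofFinite F
  rw [Nat.card_eq_fintype_card] at hF
  obtain ⟨e⟩ : Nonempty ((P → Bool) ≃ F) := Fintype.card_eq.1 (by simp [hF])
  obtain ⟨p⟩ : Nonempty (B ↪ F) := Function.Embedding.nonempty_of_card_le (hF ▸ hB)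
  let f : (Fin k → P → Bool) → Polynomial.degreeLT F k := fun c =>
    (Polynomial.degreeLTEquiv F k).symm fun m => e (c m)
  have hf : Function.Injective f := fun c c' h => by
    have h1 := (Polynomial.degreeLTEquiv F k).symm.injective h
    funext m
    exact e.injective (congrFun h1 m)
  refine ⟨fun c x => e.symm ((f c : Polynomial F).eval (p x)), fun c c' hc Z hZ => ?_⟩
  by_contra! hk
  refine hc (hf (Subtype.ext ?_))
  have hd : ∀ c, (f c : Polynomial F).degree < (Z.map p).card := fun c =>
    (Polynomial.mem_degreeLT.1 (f c).2).trans_le (by simpa using hk)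
  refine Polynomial.eq_of_degrees_lt_of_eval_finset_eq _ (hd c) (hd c') fun y hy => ?_
  obtain ⟨x, hx, rfl⟩ := Finset.mem_map.1 hy
  exact e.symm.injective (hZ x hx)

theorem mul_add_inj {n a a' r r' : ℕ} (h : a * n + r = a' * n + r') (hr : r < n) (hr' : r' < n) :
    a = a' ∧ r = r' := by
  have h1 := congrArg (· / n) h
  have h2 := congrArg (· % n) h
  simp only [mul_comm _ n, Nat.mul_add_div (by omega : 0 < n), Nat.mul_add_mod,
    Nat.div_eq_of_lt hr, Nat.div_eq_of_lt hr', Nat.mod_eq_of_lt hr, Nat.mod_eq_of_lt hr'] at h1 h2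
  exact ⟨h1, h2⟩

/-- The coordinate with offset `o + e` in block `q` of tile `T`. -/
def cellPos {τ t g v : ℕ} (Γ o : ℕ) (T : Fin τ) (q : Fin t × Fin g) (e : Fin v) : ℕ :=
  (T.val * (t * g) + (q.1.val * g + q.2.val)) * Γ + (o + e.val)

theorem block_lt {t g : ℕ} (q : Fin t × Fin g) : q.1.val * g + q.2.val < t * g := by
  nlinarith [Nat.mul_le_mul_right g (show q.1.val + 1 ≤ t from q.1.2), q.2.2]

theorem cellPos_inj {τ t g v Γ o : ℕ} (ho : o + v ≤ Γ) {T T' : Fin τ} {q q' : Fin t × Fin g}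
    {e e' : Fin v} (h : cellPos Γ o T q e = cellPos Γ o T' q' e') : T = T' ∧ q = q' ∧ e = e' := by
  have h1 := mul_add_inj h (by omega) (by omega)
  have h2 := mul_add_inj h1.1 (block_lt q) (block_lt q')
  exact ⟨Fin.ext h2.1, strip_eq h2.2, Fin.ext (by omega)⟩

open Classical in
/-- The diagonals encoding a word for every tile. -/
noncomputable def codeDiag {τ t g v k : ℕ} (Γ o : ℕ)
    (code : (Fin k → Fin v × Fin v → Bool) → (Fin t × Fin g) × (Fin t × Fin g) →
      Fin v × Fin v → Bool)
    (c : Fin τ × Fin τ → Fin k → Fin v × Fin v → Bool) (x y : ℕ) : Bool :=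
  decide (∃ T q e, x = cellPos Γ o T.1 q.1 e.1 ∧ y = cellPos Γ o T.2 q.2 e.2 ∧
    code (c T) q e = true)

theorem codeDiag_cellPos {τ t g v k Γ o : ℕ} (ho : o + v ≤ Γ)
    (code : (Fin k → Fin v × Fin v → Bool) → (Fin t × Fin g) × (Fin t × Fin g) →
      Fin v × Fin v → Bool)
    (c : Fin τ × Fin τ → Fin k → Fin v × Fin v → Bool) (T : Fin τ × Fin τ)
    (q : (Fin t × Fin g) × (Fin t × Fin g)) (e : Fin v × Fin v) :
    codeDiag Γ o code c (cellPos Γ o T.1 q.1 e.1) (cellPos Γ o T.2 q.2 e.2) =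
      code (c T) q e := by
  rw [codeDiag, Bool.eq_iff_iff, decide_eq_true_iff]
  constructor
  · rintro ⟨T', q', e', h1, h2, h3⟩
    obtain ⟨a1, a2, a3⟩ := cellPos_inj ho h1
    obtain ⟨b1, b2, b3⟩ := cellPos_inj ho h2
    rwa [Prod.ext a1 b1, Prod.ext a2 b2, Prod.ext a3 b3]
  · exact fun h => ⟨T, q, e, rfl, rfl, h⟩

end Code

section Counting

theorem card_wallSet_le {n G t b : ℕ} :
    (wallSet (n * G * t) t (IsWall b G)).card ≤ 4 * n * t * (n * G * t) := by
  classical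
  let I : Finset ℕ :=
    (Finset.range n ×ˢ Finset.range t).image (fun x => (x.1 * G + (b + 1)) * t + x.2)
    ∪ (Finset.range n ×ˢ Finset.range t).image (fun x => (x.1 * G + 2 * b) * t + x.2)
  have hI : I.card ≤ 2 * n * t := by
    refine (Finset.card_union_le _ _).trans ?_
    refine (Nat.add_le_add Finset.card_image_le Finset.card_image_le).trans ?_
    simp only [Finset.card_product, Finset.card_range]
    nlinarith
  have hmem : ∀ x < n * G * t, IsWall b G (x / t) → x ∈ I := by
    intro x hx h
    have ht : 0 < t := by
      rw [Nat.pos_iff_ne_zero]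
      rintro rfl
      simp at hx
    have hG : 0 < G := by
      rw [Nat.pos_iff_ne_zero]
      rintro rfl
      simp at hx
    have h1 : x / t / G < n := by
      rw [Nat.div_lt_iff_lt_mul hG, Nat.div_lt_iff_lt_mul ht]
      exact hx
    have h2 : (x / t / G * G + x / t % G) * t + x % t = x := by
      rw [Nat.div_add_mod', Nat.div_add_mod']
    rcases h with h | h
    · exact Finset.mem_union_left _ (Finset.mem_image.2 ⟨(x / t / G, x % t),
        by simp [h1, Nat.mod_lt _ ht], by rw [← h]; exact h2⟩)
    · exact Finset.mem_union_right _ (Finset.mem_image.2 ⟨(x / t / G, x % t),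
        by simp [h1, Nat.mod_lt _ ht], by rw [← h]; exact h2⟩)
  calc (wallSet (n * G * t) t (IsWall b G)).card
      ≤ (I ×ˢ Finset.range (n * G * t) ∪ Finset.range (n * G * t) ×ˢ I).card := by
        refine Finset.card_le_card fun p hp => ?_
        simp only [wallSet, Finset.mem_filter, Finset.mem_product, Finset.mem_range] at hp
        simp only [Finset.mem_union, Finset.mem_product, Finset.mem_range]
        rcases hp.2 with h | h
        · exact Or.inl ⟨hmem _ hp.1.1 h, hp.1.2⟩
        · exact Or.inr ⟨hp.1.1, hmem _ hp.1.2 h⟩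
    _ ≤ I.card * (n * G * t) + (n * G * t) * I.card := by
        refine (Finset.card_union_le _ _).trans ?_
        simp [Finset.card_product]
    _ ≤ 2 * n * t * (n * G * t) + (n * G * t) * (2 * n * t) := by gcongr
    _ = _ := by ring

variable {V : Type*} [Fintype V] {U : SimpleGraph V}

/-- If a `K_t`-minor-free graph contains the triangulated grids of a code, it is large. -/
theorem two_pow_le_card_pow {t b τ g k : ℕ} (ht : 2 ≤ t) (hb : 3 ≤ b) (hτ : 0 < τ)
    (hK : ¬ U.HasMinor (⊤ : SimpleGraph (Fin t))) (hg : 2 * (t ^ 4 * (t * b)) ≤ g)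
    (hk : 2 * k ≤ g ^ 2)
    (hcode : (t * g) ^ 2 ≤ 2 ^ ((t * (b - 2) - 1) ^ 2))
    (hU : ∀ d : ℕ → ℕ → Bool, ∃ ψ,
      GridEmb U (τ * (t * g) * (t ^ 2 * b + 2 * b + 2) * t) d ψ) :
    2 ^ ((t * (b - 2) - 1) ^ 2 * k * τ ^ 2) ≤
      Fintype.card V ^ (t ^ 2) * (t * (2 * t ^ 2) ^ 2) ^
        (4 * (τ * (t * g)) * t * (τ * (t * g) * (t ^ 2 * b + 2 * b + 2) * t)) := by
  classical
  set G := t ^ 2 * b + 2 * b + 2 with hG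
  set v := t * (b - 2) - 1 with hv
  set n := τ * (t * g) with hn
  have hbb : t * (b - 2) + 2 * t = t * b := by
    obtain ⟨b, rfl⟩ := Nat.exists_eq_add_of_le' (show 2 ≤ b by omega)
    rw [Nat.add_sub_cancel]
    ring
  have hb2 : 2 ≤ t * (b - 2) := by
    calc 2 = 2 * 1 := rfl
      _ ≤ t * (b - 2) := Nat.mul_le_mul ht (by omega)
  have hvpos : 0 < v := by omega
  have : Nonempty (Fin v × Fin v) := ⟨(⟨0, hvpos⟩, ⟨0, hvpos⟩)⟩
  have e2 : t * (b + 2) = t * b + 2 * t := by ring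
  have hGt : t * t * (t * b) + 2 * (t * b) + 2 * t = G * t := by
    rw [hG]
    ring
  have htb : t * b ≤ t * t * (t * b) := Nat.le_mul_of_pos_left _ (by positivity)
  have ho : t * (b + 2) + v ≤ G * t := by omega
  obtain ⟨code, hcode'⟩ := exists_code (Fin v × Fin v) ((Fin t × Fin g) × (Fin t × Fin g)) k
    (by simpa [sq] using hcode)
  let ι := Fin τ × Fin τ → Fin k → Fin v × Fin v → Bool
  let d : ι → ℕ → ℕ → Bool := codeDiag (G * t) (t * (b + 2)) code
  choose ψ hψ using fun c => hU (d c)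
  have hgpos : 0 < g := by
    have : 0 < t ^ 4 * (t * b) := by positivity
    omega
  have hnpos : 0 < n := by positivity
  have hbG : b + 1 < G := by omega
  let W := wallSet (n * G * t) t (IsWall b G)
  let B : Finset (ℕ × ℕ) := (Finset.range t ×ˢ Finset.range t).image fun p =>
    ((b + 1) * t + p.1, (b + 1) * t + p.2)
  have hWL : ∀ p ∈ W, p.1 < n * G * t ∧ p.2 < n * G * t := by
    intro p hp
    simpa using (Finset.mem_filter.1 hp).1
  have hnG : G ≤ n * G := Nat.le_mul_of_pos_left _ hnpos
  have hwall : IsWall b G (b + 1) := Or.inl (Nat.mod_eq_of_lt hbG)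
  have hBW : B ⊆ W := by
    intro p hp
    obtain ⟨⟨a, a'⟩, ha, rfl⟩ := Finset.mem_image.1 hp
    simp only [Finset.mem_product, Finset.mem_range] at ha
    have h1 : ∀ a < t, (b + 1) * t + a < n * G * t := by
      intro a ha
      nlinarith [Nat.mul_le_mul_right t (show b + 1 + 1 ≤ n * G by omega)]
    have h2 : ((b + 1) * t + a) / t = b + 1 := by
      rw [mul_comm, Nat.mul_add_div (by omega), Nat.div_eq_of_lt ha.1, add_zero]
    refine Finset.mem_filter.2 ⟨?_, Or.inl ?_⟩
    · simpa using ⟨h1 a ha.1, h1 a' ha.2⟩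
    · simpa only [h2] using hwall
  have hBc : B.card ≤ t ^ 2 := by
    refine Finset.card_image_le.trans ?_
    simp [sq]
  obtain ⟨S, hBS, hSW, hclosed, F, hF, hcard⟩ := exists_closed_agreement (by omega)
    (show 0 < 2 * t ^ 2 by positivity) hK hψ B W hBW hWL
  have hmeet : ∀ X < n * G, ∀ Y < n * G, IsWall b G X ∨ IsWall b G Y → MeetsBox t S X Y := by
    intro X hX Y hY h
    refine hclosed.meetsBox le_rfl (r := b + 1) (by omega) hwall (fun a ha a' ha' => hBS ?_) hX hY h
    exact Finset.mem_image.2 ⟨(a, a'), by simpa using ⟨ha, ha'⟩, rfl⟩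
  have hF1 : F.card ≤ 1 := by
    rw [Finset.card_le_one]
    intro c hc c' hc'
    by_contra hne
    obtain ⟨T, hT⟩ := Function.ne_iff.1 hne
    let Bad := Finset.univ.filter fun q => code (c T) q = code (c' T) q
    have hBad : Bad.card < k := hcode' _ _ hT Bad fun x hx => (Finset.mem_filter.1 hx).2
    have hTL : ∀ T : Fin τ, (T.val + 1) * (t * g) ≤ n := fun T =>
      Nat.mul_le_mul_right _ (show T.val + 1 ≤ τ from T.2)
    have hTL' : ∀ T : Fin τ, T.val * (t * g * (G * t)) + t * g * (G * t) ≤ n * G * t := by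
      intro T
      calc T.val * (t * g * (G * t)) + t * g * (G * t)
          = (T.val + 1) * (t * g) * (G * t) := by ring
        _ ≤ n * (G * t) := Nat.mul_le_mul_right _ (hTL T)
        _ = n * G * t := by ring
    have hblk : ∀ (T : Fin τ) (q : Fin t × Fin g),
        (T.val * (t * g) + (q.1.val * g + q.2.val) + 1) * G ≤ n * G := by
      intro T q
      refine Nat.mul_le_mul_right _ (le_trans ?_ (hTL T))
      have := block_lt q
      rw [add_mul, one_mul]
      omega
    refine hK (hasMinor_of_tile (hψ c) (hψ c') (A := t * (b + 1)) (β := t * b)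
      (H := t * (b + 1) + t * t * (t * b)) (G := G * t) (g := g)
      (TX := T.1.val * (t * g * (G * t))) (TY := T.2.val * (t * g * (G * t)))
      ?_ ?_ le_rfl ?_ (hTL' T.1) (hTL' T.2) hg Bad (by omega) ?_)
    · rw [mul_add, mul_one]
      omega
    · omega
    · rw [mul_add, mul_one]
      omega
    · intro q hq
      by_contra! hno
      refine hq (Finset.mem_filter.2 ⟨Finset.mem_univ _, ?_⟩)
      funext e
      have key := diagonals_eq_of_meetsBox ht (by omega) hG.ge (hψ c) (hψ c')
        (hF c hc c' hc') hmeet (hblk T.1 q.1) (hblk T.2 q.2) (fun P => by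
          convert hno P using 2 <;> ring)
        (x := cellPos (G * t) (t * (b + 2)) T.1 q.1 e.1)
        (y := cellPos (G * t) (t * (b + 2)) T.2 q.2 e.2)
        (by unfold cellPos; omega) (by unfold cellPos; omega)
      simp only [d, codeDiag_cellPos ho] at key
      exact key
  have hm : 1 ≤ t * (2 * t ^ 2) ^ 2 := Nat.succ_le_of_lt (by positivity)
  have hN : 1 ≤ Fintype.card V := by
    have : Nonempty V := ⟨ψ (Classical.arbitrary ι) (0, 0)⟩
    exact Fintype.card_pos
  calc 2 ^ (v ^ 2 * k * τ ^ 2) = Fintype.card ι := by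
        simp only [ι, Fintype.card_fun, Fintype.card_prod, Fintype.card_fin, Fintype.card_bool,
          ← pow_mul, sq]
    _ ≤ Fintype.card V ^ B.card * (t * (2 * t ^ 2) ^ 2) ^ W.card * F.card := hcard
    _ ≤ Fintype.card V ^ t ^ 2 * (t * (2 * t ^ 2) ^ 2) ^ (4 * n * t * (n * G * t)) * 1 := by
        gcongr
        exact card_wallSet_le
    _ = _ := mul_one _

end Counting

section DoubleGrid

theorem TAdj.irrefl {d : ℕ → ℕ → Bool} (p : ℕ × ℕ) : ¬ TAdj d p p := by
  unfold TAdj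
  omega

/-- The natural-number coordinates of a position. -/
def coords {ℓ : ℕ} (p : Fin ℓ × Fin ℓ) : ℕ × ℕ := (p.1.val, p.2.val)

theorem gridAdj_symm {ℓ : ℕ} {p q : Fin ℓ × Fin ℓ} (h : gridAdj p q) : gridAdj q p := by
  rcases h with ⟨h, h'⟩ | ⟨h, h'⟩
  · exact Or.inl ⟨h.symm, h'.symm⟩
  · exact Or.inr ⟨h.symm, h'.symm⟩

theorem gridAdj_sum_ne {ℓ : ℕ} {p q : Fin ℓ × Fin ℓ} (h : gridAdj p q) :
    p.1.val + p.2.val ≠ q.1.val + q.2.val := by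
  unfold gridAdj at h
  simp only [Fin.ext_iff] at h
  omega

/-- The triangulated grid with diagonals `d`. -/
def triGrid (ℓ : ℕ) (d : ℕ → ℕ → Bool) : SimpleGraph (Fin ℓ × Fin ℓ) where
  Adj p q := TAdj d (coords p) (coords q)
  symm := ⟨fun _ _ h => h.symm⟩
  loopless := ⟨fun _ h => TAdj.irrefl _ h⟩

/-- The triangulated double grid both of whose grids have diagonals `d`. -/
def doubleGrid (ℓ : ℕ) (d : ℕ → ℕ → Bool) : SimpleGraph (Fin 2 × Fin ℓ × Fin ℓ) where
  Adj x y := (x.1 = y.1 ∧ TAdj d (coords x.2) (coords y.2)) ∨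
    (x.1 ≠ y.1 ∧ onBoundary x.2 ∧ onBoundary y.2 ∧ (x.2 = y.2 ∨ gridAdj x.2 y.2 ∧
      (x.1 = 0 ↔ x.2.1.val + x.2.2.val < y.2.1.val + y.2.2.val)))
  symm := ⟨by
    rintro ⟨i, p⟩ ⟨j, q⟩ (⟨h, h'⟩ | ⟨h1, h2, h3, h4⟩)
    · exact Or.inl ⟨h.symm, h'.symm⟩
    · refine Or.inr ⟨h1.symm, h3, h2, h4.imp Eq.symm fun h => ⟨gridAdj_symm h.1, ?_⟩⟩
      have hne := gridAdj_sum_ne h.1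
      have h5 := h.2
      simp only [ne_eq, Fin.ext_iff, Fin.val_zero] at h1 h5 hne ⊢
      omega⟩
  loopless := ⟨by
    rintro x (⟨-, h⟩ | ⟨h, -⟩)
    · exact TAdj.irrefl _ h
    · exact h rfl⟩

theorem isTriangulatedGrid_triGrid (ℓ : ℕ) (d : ℕ → ℕ → Bool) :
    IsTriangulatedGrid (triGrid ℓ d) := by
  refine ⟨fun p q h => ?_, fun p q h => ?_, fun p q r s h1 h2 h3 h4 h5 h6 => ?_⟩
  · simp only [gridAdj, Fin.ext_iff] at h
    simp only [triGrid, TAdj, coords]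
    omega
  · simp only [triGrid, TAdj, coords] at h
    simp only [gridAdj, diagAdj, Fin.ext_iff]
    omega
  · have e1 : (triGrid ℓ d).Adj p r ↔ d p.1 p.2 = true := by
      simp only [triGrid, TAdj, coords]
      constructor
      · rintro (h | h | h | h | h | h)
        · omega
        · omega
        · exact h.2.2
        all_goals omega
      · exact fun h => Or.inr (Or.inr (Or.inl ⟨h1, h2, h⟩))
    have e2 : (triGrid ℓ d).Adj q s ↔ d p.1 p.2 = false := by
      simp only [triGrid, TAdj, coords]
      rw [h4, h5]
      constructor
      · rintro (h | h | h | h | h | h)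
        · omega
        · omega
        · omega
        · omega
        · omega
        · exact h.2.2
      · exact fun h => Or.inr (Or.inr (Or.inr (Or.inr (Or.inr ⟨by omega, by omega, h⟩))))
    rw [e1, e2]
    cases d p.1 p.2
    · exact Or.inr ⟨rfl, Bool.false_ne_true⟩
    · exact Or.inl ⟨rfl, Bool.false_ne_true.symm⟩

theorem isTriangulatedDoubleGrid_doubleGrid (ℓ : ℕ) (d : ℕ → ℕ → Bool) :
    IsTriangulatedDoubleGrid (doubleGrid ℓ d) := by
  refine ⟨triGrid ℓ d, triGrid ℓ d, isTriangulatedGrid_triGrid ℓ d, isTriangulatedGrid_triGrid ℓ d,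
    fun p q => by simp [doubleGrid, triGrid], fun p q => by simp [doubleGrid, triGrid],
    fun p => by simp [doubleGrid], fun p q hpq h => ?_, fun p q h hp hq => ?_⟩
  · rcases h with ⟨h, -⟩ | ⟨-, h1, h2, h3⟩
    · exact absurd h Fin.zero_ne_one
    · exact ⟨h1, h2, (h3.resolve_left hpq).1⟩
  · have hne := gridAdj_sum_ne h
    have hpq : p ≠ q := fun e => hne (e ▸ rfl)
    simp only [doubleGrid, hp, hq, h, gridAdj_symm h, hpq, hpq.symm]
    rcases lt_or_gt_of_ne hne with h1 | h1
    · exact Or.inl (by simp [h1, h1.le])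
    · exact Or.inr (by simp [h1, h1.le])

variable {V : Type*} {U : SimpleGraph V}

theorem GridEmb.mono {L L' : ℕ} {d : ℕ → ℕ → Bool} {ψ : ℕ × ℕ → V} (h : GridEmb U L d ψ)
    (hL : L' ≤ L) : GridEmb U L' d ψ where
  inj p q h1 h2 h3 h4 := h.inj p q (by omega) (by omega) (by omega) (by omega)
  adj p q h1 h2 h3 h4 := h.adj p q (by omega) (by omega) (by omega) (by omega)

theorem exists_gridEmb {ℓ : ℕ} (hℓ : 0 < ℓ) {d : ℕ → ℕ → Bool}
    (h : ContainsSub U (doubleGrid ℓ d)) : ∃ ψ, GridEmb U ℓ d ψ := by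
  obtain ⟨f, hf, hadj⟩ := h
  let s : ℕ → Fin ℓ := fun n => ⟨n % ℓ, Nat.mod_lt _ hℓ⟩
  have hs : ∀ n < ℓ, (s n).val = n := fun n hn => Nat.mod_eq_of_lt hn
  refine ⟨fun p => f (0, s p.1, s p.2), ⟨fun p q h1 h2 h3 h4 e => ?_, fun p q h1 h2 h3 h4 e => ?_⟩⟩
  · have := hf e
    simp only [Prod.mk.injEq, Fin.ext_iff, hs _ h1, hs _ h2, hs _ h3, hs _ h4] at this
    exact Prod.ext this.2.1 this.2.2
  · refine hadj _ _ (Or.inl ⟨rfl, ?_⟩)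
    simpa only [coords, hs _ h1, hs _ h2, hs _ h3, hs _ h4] using e

end DoubleGrid

section Parameters

/-- The side length, in boxes, of the core of a block together with its walls. -/
def coreSide (t : ℕ) : ℕ := 200 * t ^ 7 + 2

/-- The side length of a tile. -/
def tileSide (t : ℕ) : ℕ :=
  t * (2 * (t ^ 4 * (t * coreSide t))) * (t ^ 2 * coreSide t + 2 * coreSide t + 2) * t

theorem tileSide_le (t : ℕ) : tileSide t ≤ 245632 * (t + 1) ^ 23 := by
  obtain ⟨s, hs⟩ : ∃ s, s = t + 1 := ⟨_, rfl⟩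
  rw [← hs]
  have hs1 : 1 ≤ s := by omega
  have hts : t ≤ s := by omega
  have hb : coreSide t ≤ 202 * s ^ 7 := by
    have h1 : t ^ 7 ≤ s ^ 7 := Nat.pow_le_pow_left hts 7
    have h2 : 1 ≤ s ^ 7 := Nat.one_le_pow _ _ hs1
    unfold coreSide
    omega
  have hG : t ^ 2 * coreSide t + 2 * coreSide t + 2 ≤ 608 * s ^ 9 := by
    have h1 : s ^ 7 ≤ s ^ 9 := Nat.pow_le_pow_right hs1 (by omega)
    have h2 : 1 ≤ s ^ 9 := Nat.one_le_pow _ _ hs1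
    have h3 : t ^ 2 * coreSide t ≤ s ^ 2 * (202 * s ^ 7) := by gcongr
    have h4 : s ^ 2 * (202 * s ^ 7) = 202 * s ^ 9 := by ring
    omega
  calc tileSide t
      ≤ s * (2 * (s ^ 4 * (s * (202 * s ^ 7)))) * (608 * s ^ 9) * s := by
        unfold tileSide
        gcongr
    _ = 245632 * s ^ 23 := by ring

theorem coreSide_bound {t : ℕ} (ht : 1 ≤ t) :
    (2 + 5 * t) * (8 * t ^ 3 * ((t ^ 2 * coreSide t + 2 * coreSide t + 2) * t)) + 1 ≤
      (t * (coreSide t - 2) - 1) ^ 2 := by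
  have hpow : ∀ i j, i ≤ j → t ^ i ≤ t ^ j := fun i j => Nat.pow_le_pow_right ht
  have hv : 199 * t ^ 8 ≤ t * (coreSide t - 2) - 1 := by
    have h1 : t * (coreSide t - 2) = 200 * t ^ 8 := by
      rw [coreSide, Nat.add_sub_cancel]
      ring
    have := hpow 0 8 (by omega)
    rw [pow_zero] at this
    omega
  have hG : t ^ 2 * coreSide t + 2 * coreSide t + 2 ≤ 608 * t ^ 9 := by
    have e : t ^ 2 * coreSide t = 200 * t ^ 9 + 2 * t ^ 2 := by
      unfold coreSide
      ring
    have h1 := hpow 7 9 (by omega)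
    have h2 := hpow 2 9 (by omega)
    have h3 := hpow 0 9 (by omega)
    rw [pow_zero] at h3
    rw [e]
    unfold coreSide
    omega
  calc (2 + 5 * t) * (8 * t ^ 3 * ((t ^ 2 * coreSide t + 2 * coreSide t + 2) * t)) + 1
      ≤ (7 * t) * (8 * t ^ 3 * ((608 * t ^ 9) * t)) + 1 := by
        gcongr
        omega
    _ = 34048 * t ^ 14 + t ^ 0 := by ring
    _ ≤ 34048 * t ^ 16 + t ^ 16 := by gcongr <;> omega
    _ ≤ (199 * t ^ 8) ^ 2 := by
        have : (199 * t ^ 8) ^ 2 = 39601 * t ^ 16 := by ring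
        omega
    _ ≤ _ := Nat.pow_le_pow_left hv 2

theorem card_blocks_le {t : ℕ} (ht : 1 ≤ t) :
    (t * (2 * (t ^ 4 * (t * coreSide t)))) ^ 2 ≤ 2 ^ ((t * (coreSide t - 2) - 1) ^ 2) := by
  have hb : coreSide t ≤ 202 * t ^ 7 := by
    have : 1 ≤ t ^ 7 := Nat.one_le_pow _ _ ht
    unfold coreSide
    omega
  have h2 : t ≤ 2 ^ t := Nat.lt_two_pow_self.le
  have h8 : 26 * t + 18 ≤ (t * (coreSide t - 2) - 1) ^ 2 := by
    refine le_trans ?_ (coreSide_bound ht)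
    have : 1 ≤ t ^ 3 * ((t ^ 2 * coreSide t + 2 * coreSide t + 2) * t) := by
      exact Nat.succ_le_of_lt (by positivity)
    nlinarith
  calc (t * (2 * (t ^ 4 * (t * coreSide t)))) ^ 2
      ≤ (t * (2 * (t ^ 4 * (t * (202 * t ^ 7))))) ^ 2 := by gcongr
    _ = 163216 * t ^ 26 := by ring
    _ ≤ 2 ^ 18 * (2 ^ t) ^ 26 := by
        gcongr
        norm_num
    _ = 2 ^ (26 * t + 18) := by ring
    _ ≤ _ := Nat.pow_le_pow_right (by omega) h8

variable {V : Type*} [Fintype V] {U : SimpleGraph V}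

theorem two_pow_sq_le {t τ : ℕ} (ht : 2 ≤ t) (hτ : 0 < τ)
    (hK : ¬ U.HasMinor (⊤ : SimpleGraph (Fin t)))
    (hU : ∀ d : ℕ → ℕ → Bool, ∃ ψ, GridEmb U (τ * tileSide t) d ψ) :
    2 ^ (τ ^ 2) ≤ Fintype.card V ^ (t ^ 2) := by
  obtain ⟨b, hbdef⟩ : ∃ b, b = coreSide t := ⟨_, rfl⟩
  obtain ⟨g, hgdef⟩ : ∃ g, g = 2 * (t ^ 4 * (t * b)) := ⟨_, rfl⟩
  obtain ⟨Γ, hΓ⟩ : ∃ Γ, Γ = (t ^ 2 * b + 2 * b + 2) * t := ⟨_, rfl⟩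
  obtain ⟨k, hk⟩ : ∃ k, k = 2 * (t ^ 4 * (t * b)) ^ 2 := ⟨_, rfl⟩
  have hb : 3 ≤ b := by
    have : 1 ≤ t ^ 7 := Nat.one_le_pow _ _ (by omega)
    rw [hbdef]
    unfold coreSide
    omega
  have hkg : 2 * k = g ^ 2 := by
    rw [hk, hgdef]
    ring
  have hkpos : 1 ≤ k := by
    rw [hk]
    exact Nat.succ_le_of_lt (by positivity)
  have main := two_pow_le_card_pow ht hb hτ hK hgdef.ge hkg.le
    (by rw [hgdef, hbdef]; exact card_blocks_le (by omega)) (fun d => by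
      obtain ⟨ψ, hψ⟩ := hU d
      refine ⟨ψ, ?_⟩
      convert hψ using 1
      rw [tileSide, ← hbdef, ← hgdef]
      ring)
  have hbound := coreSide_bound (show 1 ≤ t by omega)
  rw [← hbdef, ← hΓ] at hbound
  set v := t * (b - 2) - 1
  have hE : 4 * (τ * (t * g)) * t * (τ * (t * g) * (t ^ 2 * b + 2 * b + 2) * t) =
      8 * t ^ 3 * Γ * k * τ ^ 2 := by
    calc _ = 4 * t ^ 3 * Γ * g ^ 2 * τ ^ 2 := by
          rw [hΓ]
          ring
      _ = _ := by
          rw [← hkg]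
          ring
  rw [hE] at main
  have hbase : t * (2 * t ^ 2) ^ 2 ≤ 2 ^ (2 + 5 * t) := by
    have h2 : t ≤ 2 ^ t := Nat.lt_two_pow_self.le
    calc t * (2 * t ^ 2) ^ 2 = 4 * t ^ 5 := by ring
      _ ≤ 4 * (2 ^ t) ^ 5 := by gcongr
      _ = 2 ^ (2 + 5 * t) := by ring
  have hexp : τ ^ 2 + (2 + 5 * t) * (8 * t ^ 3 * Γ * k * τ ^ 2) ≤ v ^ 2 * k * τ ^ 2 := by
    calc τ ^ 2 + (2 + 5 * t) * (8 * t ^ 3 * Γ * k * τ ^ 2)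
        = (1 + (2 + 5 * t) * (8 * t ^ 3 * Γ) * k) * τ ^ 2 := by ring
      _ ≤ (k + (2 + 5 * t) * (8 * t ^ 3 * Γ) * k) * τ ^ 2 := by gcongr
      _ = ((2 + 5 * t) * (8 * t ^ 3 * Γ) + 1) * k * τ ^ 2 := by ring
      _ ≤ v ^ 2 * k * τ ^ 2 := by gcongr
  refine Nat.le_of_mul_le_mul_right (c := 2 ^ ((2 + 5 * t) * (8 * t ^ 3 * Γ * k * τ ^ 2))) ?_
    (by positivity)
  calc 2 ^ (τ ^ 2) * 2 ^ ((2 + 5 * t) * (8 * t ^ 3 * Γ * k * τ ^ 2))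
      = 2 ^ (τ ^ 2 + (2 + 5 * t) * (8 * t ^ 3 * Γ * k * τ ^ 2)) := (pow_add _ _ _).symm
    _ ≤ 2 ^ (v ^ 2 * k * τ ^ 2) := Nat.pow_le_pow_right (by omega) hexp
    _ ≤ _ := main
    _ ≤ Fintype.card V ^ t ^ 2 * (2 ^ (2 + 5 * t)) ^ (8 * t ^ 3 * Γ * k * τ ^ 2) := by gcongr
    _ = _ := by rw [← pow_mul]

end Parameters

end GridMinor

open GridMinor in
/-- There is a polynomially bounded function `f : ℕ → ℕ` such that for all
`t ≥ 2` and `ℓ ≥ 2`, every `K_t`-minor-free graph `U` containing every triangulated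
`ℓ × ℓ` double grid as a subgraph satisfies `|V(U)| ≥ 2^(ℓ² / f t)`. -/
theorem statement0 :
    ∃ f : ℕ → ℕ,
      (∃ C c : ℕ, ∀ t, f t ≤ C * (t + 1) ^ c) ∧
      (∀ t, 0 < f t) ∧
      ∀ t ℓ : ℕ, 2 ≤ t → 2 ≤ ℓ →
        ∀ (N : ℕ) (U : SimpleGraph (Fin N)),
          ¬ U.HasMinor (⊤ : SimpleGraph (Fin t)) →
          (∀ H : SimpleGraph (Fin 2 × Fin ℓ × Fin ℓ),
            IsTriangulatedDoubleGrid H → ContainsSub U H) →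
          (2 : ℝ) ^ ((ℓ : ℝ) ^ 2 / (f t : ℝ)) ≤ (N : ℝ) := by
  refine ⟨fun t => 4 * tileSide t ^ 2 * t ^ 2 + 1, ⟨4 * 245632 ^ 2 + 1, 48, fun t => ?_⟩,
    fun t => Nat.succ_pos _, fun t ℓ ht hℓ N U hK hU => ?_⟩
  · calc 4 * tileSide t ^ 2 * t ^ 2 + 1
        ≤ 4 * (245632 * (t + 1) ^ 23) ^ 2 * (t + 1) ^ 2 + (t + 1) ^ 48 := by
          gcongr
          · exact tileSide_le t
          · omega
          · exact Nat.one_le_pow _ _ (Nat.succ_pos t)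
      _ = (4 * 245632 ^ 2 + 1) * (t + 1) ^ 48 := by ring
  have hemb : ∀ d, ∃ ψ, GridEmb U ℓ d ψ := fun d =>
    exists_gridEmb (by omega) (hU _ (isTriangulatedDoubleGrid_doubleGrid ℓ d))
  obtain ⟨D, hD⟩ : ∃ D, D = tileSide t := ⟨_, rfl⟩
  have hDpos : 0 < D := by
    rw [hD, tileSide]
    unfold coreSide
    positivity
  beta_reduce
  rw [← hD]
  rcases Nat.lt_or_ge ℓ D with hlt | hge
  · have hN : 2 ≤ N := by
      obtain ⟨ψ, hψ⟩ := hemb fun _ _ => true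
      have := hψ.adj (0, 0) (0, 1) (by simp; omega) (by simp; omega) (by simp; omega)
        (by simp; omega) (Or.inl ⟨rfl, Or.inl rfl⟩)
      have h1 := Fintype.one_lt_card_iff.2 ⟨_, _, this.ne⟩
      rwa [Fintype.card_fin] at h1
    have hle : ℓ ^ 2 ≤ 4 * D ^ 2 * t ^ 2 + 1 := by
      have h1 : ℓ ^ 2 ≤ D ^ 2 := Nat.pow_le_pow_left hlt.le 2
      have h2 : D ^ 2 * 1 ≤ D ^ 2 * (4 * t ^ 2) :=
        Nat.mul_le_mul_left _ (Nat.succ_le_of_lt (by positivity))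
      linarith
    calc (2 : ℝ) ^ ((ℓ : ℝ) ^ 2 / ((4 * D ^ 2 * t ^ 2 + 1 : ℕ) : ℝ)) ≤ 2 ^ (1 : ℝ) := by
          refine Real.rpow_le_rpow_of_exponent_le one_le_two ?_
          refine div_le_one_of_le₀ ?_ (Nat.cast_nonneg _)
          exact_mod_cast hle
      _ = 2 := Real.rpow_one 2
      _ ≤ N := by exact_mod_cast hN
  · have hτ : 0 < ℓ / D := Nat.div_pos hge hDpos
    have hmain := two_pow_sq_le ht hτ hK fun d => by
      obtain ⟨ψ, hψ⟩ := hemb d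
      exact ⟨ψ, hψ.mono (hD ▸ Nat.div_mul_le_self ℓ D)⟩
    rw [Fintype.card_fin] at hmain
    have hℓτ : ℓ ≤ 2 * D * (ℓ / D) := by
      have h1 := Nat.lt_mul_div_succ ℓ hDpos
      nlinarith
    have hle : ℓ ^ 2 * t ^ 2 ≤ (ℓ / D) ^ 2 * (4 * D ^ 2 * t ^ 2 + 1) := by
      calc ℓ ^ 2 * t ^ 2 ≤ (2 * D * (ℓ / D)) ^ 2 * t ^ 2 := by gcongr
        _ = (ℓ / D) ^ 2 * (4 * D ^ 2 * t ^ 2) := by ring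
        _ ≤ _ := by gcongr; omega
    have ht2 : t ^ 2 ≠ 0 := by positivity
    refine (pow_le_pow_iff_left₀ (by positivity) (Nat.cast_nonneg N) ht2).1 ?_
    calc ((2 : ℝ) ^ ((ℓ : ℝ) ^ 2 / ((4 * D ^ 2 * t ^ 2 + 1 : ℕ) : ℝ))) ^ t ^ 2
        = 2 ^ ((ℓ : ℝ) ^ 2 / ((4 * D ^ 2 * t ^ 2 + 1 : ℕ) : ℝ) * (t ^ 2 : ℕ)) := by
          rw [Real.rpow_mul_natCast zero_le_two]
      _ ≤ 2 ^ (((ℓ / D) ^ 2 : ℕ) : ℝ) := by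
          refine Real.rpow_le_rpow_of_exponent_le one_le_two ?_
          rw [div_mul_eq_mul_div, div_le_iff₀ (by positivity)]
          exact_mod_cast hle
      _ = ((2 ^ (ℓ / D) ^ 2 : ℕ) : ℝ) := by
          rw [Real.rpow_natCast]
          push_cast
          rfl
      _ ≤ ((N ^ t ^ 2 : ℕ) : ℝ) := by exact_mod_cast hmain
      _ = (N : ℝ) ^ t ^ 2 := by push_cast; rfl
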